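/- arXiv:math/0202124 — 3 statements merged into one kernel-verified Lean document; each statement's English description precedes it below -/
import Mathlib

section
/- If a finitely presented group ⟨A;R⟩ admits D : ℕ → ℕ such that every word w of length ≤ n representing the identity can be written in the free group as a product ∏ x_i⁻¹ r_i x_i with all |x_i| ≤ D(n), and D is computable, then the word problem of ⟨A;R⟩ is decidable. -/
namespace WordProblemAux

open Primrec

/-- Apply a list of transpositions to a number (rightmost first). -/
def sw (L : List (ℕ × ℕ)) (x : ℕ) : ℕ :=
  L.foldr (fun p y => if y = p.1 then p.2 else if y = p.2 then p.1 else y) x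

/-- The permutation given by a list of transpositions. -/
def perm (L : List (ℕ × ℕ)) : Equiv.Perm ℕ := (L.map fun p => Equiv.swap p.1 p.2).prod

theorem sw_eq (L : List (ℕ × ℕ)) (x : ℕ) : sw L x = perm L x := by
  induction L with
  | nil => simp [sw, perm]
  | cons p L ih =>
    have : sw (p :: L) x =
      if sw L x = p.1 then p.2 else if sw L x = p.2 then p.1 else sw L x := rfl
    have h2 : perm (p :: L) x = Equiv.swap p.1 p.2 (perm L x) := by simp [perm]
    rw [this, ih, h2, Equiv.swap_apply_def]

theorem perm_reverse (L : List (ℕ × ℕ)) : perm L.reverse = (perm L)⁻¹ := by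
  simp [perm, List.prod_inv_reverse, Function.comp_def, List.map_reverse]

theorem primrec_sw : Primrec₂ sw := by
  unfold sw
  refine Primrec.list_foldr (h := fun (_ : List (ℕ × ℕ) × ℕ) (q : (ℕ × ℕ) × ℕ) =>
    if q.2 = q.1.1 then q.1.2 else if q.2 = q.1.2 then q.1.1 else q.2) fst snd ?_
  have h1 : Primrec fun q : (List (ℕ × ℕ) × ℕ) × ((ℕ × ℕ) × ℕ) => q.2.1.1 :=
    fst.comp (fst.comp snd)
  have h2 : Primrec fun q : (List (ℕ × ℕ) × ℕ) × ((ℕ × ℕ) × ℕ) => q.2.1.2 :=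
    snd.comp (fst.comp snd)
  have h3 : Primrec fun q : (List (ℕ × ℕ) × ℕ) × ((ℕ × ℕ) × ℕ) => q.2.2 :=
    snd.comp snd
  exact Primrec.ite (Primrec.eq.comp h3 h1) h2 (Primrec.ite (Primrec.eq.comp h3 h2) h1 h3)

theorem exists_swaps {P : Type*} [DecidableEq P] (g h : P → ℕ) (hg : g.Injective)
    (hh : h.Injective) (s : Finset P) : ∃ L, ∀ x ∈ s, perm L (g x) = h x := by
  induction s using Finset.induction_on with
  | empty => exact ⟨[], by simp⟩
  | insert a s ha ih =>
    obtain ⟨L, hL⟩ := ih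
    refine ⟨(perm L (g a), h a) :: L, fun x hx => ?_⟩
    have e : perm ((perm L (g a), h a) :: L) (g x) =
      Equiv.swap (perm L (g a)) (h a) (perm L (g x)) := by simp [perm]
    rw [e]
    rcases Finset.mem_insert.1 hx with rfl | hx
    · simp
    · have hne : x ≠ a := fun h => ha (h ▸ hx)
      rw [Equiv.swap_apply_of_ne_of_ne, hL x hx]
      · exact fun h => hne (hg ((perm L).injective h))
      · rw [hL x hx]; exact fun h => hne (hh h)

set_option linter.unusedSectionVars false

section
variable {α : Type} [Fintype α] [DecidableEq α] [Primcodable α]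

/-- Numbering of generators. -/
noncomputable def idx (a : α) : ℕ := (Fintype.equivFin α a : ℕ)

/-- The permutation assigned to a generator. -/
noncomputable def sig (c : List (List (ℕ × ℕ))) (a : α) : Equiv.Perm ℕ := perm (c.getD (idx a) [])

/-- Action of a letter. -/
noncomputable def letter (c : List (List (ℕ × ℕ))) (l : α × Bool) (x : ℕ) : ℕ :=
  bif l.2 then sw (c.getD (idx l.1) []) x else sw (c.getD (idx l.1) []).reverse x

/-- Action of a word. -/
noncomputable def actW (c : List (List (ℕ × ℕ))) (w : List (α × Bool)) (x : ℕ) : ℕ :=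
  w.foldr (fun l y => letter c l y) x

theorem letter_eq (c : List (List (ℕ × ℕ))) (l : α × Bool) (x : ℕ) :
    letter c l x = FreeGroup.lift (sig c) (FreeGroup.mk [l]) x := by
  rcases l with ⟨a, b⟩
  cases b <;> simp [letter, sig, sw_eq, perm_reverse, FreeGroup.lift_mk]

theorem actW_eq (c : List (List (ℕ × ℕ))) (w : List (α × Bool)) (x : ℕ) :
    actW c w x = FreeGroup.lift (sig c) (FreeGroup.mk w) x := by
  induction w with
  | nil => simp [actW, FreeGroup.lift_mk]
  | cons l w ih =>
    have : actW c (l :: w) x = letter c l (actW c w x) := rfl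
    have h2 : FreeGroup.mk (l :: w) = FreeGroup.mk [l] * FreeGroup.mk w := by simp
    rw [this, letter_eq, ih, h2, map_mul, Equiv.Perm.mul_apply]

theorem primrec_letter :
    Primrec fun q : List (List (ℕ × ℕ)) × (α × Bool) × ℕ => letter q.1 q.2.1 q.2.2 := by
  have h : Primrec fun q : List (List (ℕ × ℕ)) × (α × Bool) × ℕ => q.1.getD (idx q.2.1.1) [] :=
    (Primrec.list_getD []).comp fst
      ((Primrec.dom_finite (idx : α → ℕ)).comp (fst.comp (fst.comp snd)))
  exact Primrec.cond (snd.comp (fst.comp snd)) (primrec_sw.comp h (snd.comp snd))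
    (primrec_sw.comp (list_reverse.comp h) (snd.comp snd))

theorem primrec_actW :
    Primrec fun q : List (List (ℕ × ℕ)) × List (α × Bool) × ℕ => actW q.1 q.2.1 q.2.2 := by
  unfold actW
  exact Primrec.list_foldr
    (h := fun (q : List (List (ℕ × ℕ)) × List (α × Bool) × ℕ) (s : (α × Bool) × ℕ) =>
      letter q.1 s.1 s.2) (fst.comp snd) (snd.comp snd)
    (primrec_letter.comp (pair (fst.comp fst) snd))

/-- All words of length at most `d`. -/
noncomputable def words (α : Type) [Fintype α] (d : ℕ) : List (List (α × Bool)) :=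
  Nat.rec [[]] (fun _ W => W ++ W.flatMap fun x =>
    (Finset.univ : Finset (α × Bool)).toList.map fun l => l :: x) d

theorem primrec_words : Primrec (words α) := by
  unfold words
  refine Primrec.nat_rec₁ [[]] ?_
  refine list_append.comp snd (list_flatMap snd ?_)
  exact list_map (const _) (list_cons.comp snd (snd.comp fst))

theorem mem_words (d : ℕ) (x : List (α × Bool)) (h : x.length ≤ d) : x ∈ words α d := by
  induction d generalizing x with
  | zero => simp at h; subst h; simp [words]
  | succ d ih =>
    have e : words α (d + 1) = words α d ++ (words α d).flatMap fun x =>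
      (Finset.univ : Finset (α × Bool)).toList.map fun l => l :: x := rfl
    rw [e]
    cases x with
    | nil => exact List.mem_append_left _ (ih _ (by simp))
    | cons l x =>
      refine List.mem_append_right _ (List.mem_flatMap.2 ⟨x, ih x (by simpa using h), ?_⟩)
      exact List.mem_map.2 ⟨l, by simp, rfl⟩

theorem primrec_reduce : Primrec (FreeGroup.reduce : List (α × Bool) → List (α × Bool)) := by
  have hstep : Primrec fun q : (α × Bool) × List (α × Bool) =>
      (List.casesOn q.2 [q.1] fun hd tl =>
        if q.1.1 = hd.1 ∧ q.1.2 = not hd.2 then tl else q.1 :: hd :: tl : List (α × Bool)) := by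
    refine list_casesOn (h := fun (q : (α × Bool) × List (α × Bool))
      (s : (α × Bool) × List (α × Bool)) =>
      if q.1.1 = s.1.1 ∧ q.1.2 = not s.1.2 then s.2 else q.1 :: s.1 :: s.2) snd
      (list_cons.comp fst (const [])) ?_
    refine Primrec.ite (PrimrecPred.and ?_ ?_) (snd.comp snd)
      (list_cons.comp (fst.comp fst) (list_cons.comp (fst.comp snd) (snd.comp snd)))
    · exact Primrec.eq.comp (fst.comp (fst.comp fst)) (fst.comp (fst.comp snd))
    · exact Primrec.eq.comp (snd.comp (fst.comp fst)) (Primrec.not.comp (snd.comp (fst.comp snd)))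
  refine (Primrec.list_foldr (h := fun (_ : List (α × Bool)) (q : (α × Bool) × List (α × Bool)) =>
    (List.casesOn q.2 [q.1] fun hd tl =>
        if q.1.1 = hd.1 ∧ q.1.2 = not hd.2 then tl else q.1 :: hd :: tl : List (α × Bool)))
    Primrec.id (const []) (Primrec.to₂ (hstep.comp snd))).of_eq fun w => ?_
  induction w with
  | nil => rfl
  | cons l w ih =>
    rw [FreeGroup.reduce.cons, ← ih]
    rfl

theorem primrec_invRev : Primrec (FreeGroup.invRev : List (α × Bool) → List (α × Bool)) := by
  unfold FreeGroup.invRev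
  exact list_reverse.comp (list_map Primrec.id
    (((dom_finite fun g : α × Bool => (g.1, !g.2)).comp snd).to₂))

/-- The word spelled by a positive certificate. -/
def posWord (R : List (List (α × Bool))) (L : List (ℕ × List (α × Bool))) : List (α × Bool) :=
  L.flatMap fun p => FreeGroup.invRev p.2 ++ (R.getD p.1 [] ++ p.2)

theorem primrec_posWord (R : List (List (α × Bool))) : Primrec (posWord R) := by
  unfold posWord
  refine list_flatMap Primrec.id ?_
  refine list_append.comp (primrec_invRev.comp (snd.comp snd)) (list_append.comp ?_ (snd.comp snd))
  exact (list_getD []).comp (const R) (fst.comp snd)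

theorem mk_posWord (R : List (List (α × Bool))) (L : List (ℕ × List (α × Bool))) :
    FreeGroup.mk (posWord R L) = (L.map fun p => (FreeGroup.mk p.2)⁻¹ *
      FreeGroup.mk (R.getD p.1 []) * FreeGroup.mk p.2).prod := by
  induction L with
  | nil => rfl
  | cons p L ih =>
    have : posWord R (p :: L) =
      (FreeGroup.invRev p.2 ++ (R.getD p.1 [] ++ p.2)) ++ posWord R L := rfl
    rw [this, ← FreeGroup.mul_mk, ih, ← FreeGroup.mul_mk, ← FreeGroup.mul_mk, ← FreeGroup.inv_mk]
    simp [mul_assoc]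

/-- Pairs of relators and short conjugators. -/
noncomputable def rxs (R : List (List (α × Bool))) (d : ℕ) :
    List (List (α × Bool) × List (α × Bool)) :=
  (words α d).flatMap fun x => R.map fun r => (r, x)

theorem primrec_rxs (R : List (List (α × Bool))) : Primrec (rxs R) := by
  unfold rxs
  refine list_flatMap primrec_words ?_
  exact list_map (const _) (pair snd (snd.comp fst))

/-- Validity of a positive certificate. -/
def Pos (R : List (List (α × Bool))) (w : List (α × Bool)) (L : List (ℕ × List (α × Bool))) :
    Prop := FreeGroup.reduce w = FreeGroup.reduce (posWord R L)

/-- Validity of a negative certificate. -/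
def Neg (R : List (List (α × Bool))) (w : List (α × Bool)) (d : ℕ)
    (c : ℕ × List (List (ℕ × ℕ))) : Prop :=
  (∀ p ∈ rxs R d, actW c.2 p.1 (actW c.2 p.2 c.1) = actW c.2 p.2 c.1) ∧ actW c.2 w c.1 ≠ c.1

/-- Certificates, positive and negative together. -/
abbrev Cert (α : Type) := List (ℕ × List (α × Bool)) × (ℕ × List (List (ℕ × ℕ)))

open Classical in
/-- Checking a certificate. -/
noncomputable def chk (R : List (List (α × Bool))) (q : (List (α × Bool) × ℕ) × Cert α) :
    Option Bool :=
  if Pos R q.1.1 q.2.1 then some true else if Neg R q.1.1 q.1.2 q.2.2 then some false else none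

theorem primrec_chk (R : List (List (α × Bool))) : Primrec (chk R) := by
  classical
  unfold chk
  refine Primrec.ite ?_ (const _) (Primrec.ite ?_ (const _) (const _))
  · exact Primrec.eq.comp (primrec_reduce.comp (fst.comp fst))
      (primrec_reduce.comp ((primrec_posWord R).comp (fst.comp snd)))
  · refine PrimrecPred.and ?_ (PrimrecPred.not ?_)
    · have h : PrimrecRel fun (p : List (α × Bool) × List (α × Bool))
          (c : ℕ × List (List (ℕ × ℕ))) =>
          actW c.2 p.1 (actW c.2 p.2 c.1) = actW c.2 p.2 c.1 := by
        have h2 : Primrec fun q : (List (α × Bool) × List (α × Bool)) ×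
            (ℕ × List (List (ℕ × ℕ))) => actW q.2.2 q.1.2 q.2.1 :=
          primrec_actW.comp (pair (snd.comp snd) (pair (snd.comp fst) (fst.comp snd)))
        exact Primrec.eq.comp
          (primrec_actW.comp (pair (snd.comp snd) (pair (fst.comp fst) h2))) h2
      exact h.forall_mem_list.comp ((primrec_rxs R).comp (snd.comp fst)) (snd.comp snd)
    · exact Primrec.eq.comp (primrec_actW.comp (pair (snd.comp (snd.comp snd))
        (pair (fst.comp fst) (fst.comp (snd.comp snd))))) (fst.comp (snd.comp snd))

/-- Any finite set of words not containing relations acts faithfully near a base point. -/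
theorem exists_action {P : Type} [Group P] [Countable P] (φ : FreeGroup α →* P)
    (T : List (List (α × Bool))) :
    ∃ (e : P → ℕ) (c : List (List (ℕ × ℕ))), e.Injective ∧
      ∀ u ∈ T, actW c u (e 1) = e (φ (FreeGroup.mk u)) := by
  classical
  obtain ⟨e, he⟩ := Countable.exists_injective_nat P
  let V : Finset P := ((T.flatMap List.tails).map fun u => φ (FreeGroup.mk u)).toFinset
  have hL : ∀ a : α, ∃ L, ∀ x ∈ V ∪ V.image (fun y => (φ (FreeGroup.of a))⁻¹ * y),
      perm L (e x) = e (φ (FreeGroup.of a) * x) := fun a =>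
    exists_swaps e (fun x => e (φ (FreeGroup.of a) * x)) he
      (he.comp (mul_right_injective _)) _
  choose L hL using hL
  let c := List.ofFn fun i => L ((Fintype.equivFin α).symm i)
  have hc : ∀ a, sig c a = perm (L a) := by
    intro a
    simp [sig, c, idx, List.getD_eq_getElem?_getD]
  refine ⟨e, c, he, ?_⟩
  have key : ∀ u : List (α × Bool), (∀ v, v <:+ u → φ (FreeGroup.mk v) ∈ V) →
      actW c u (e 1) = e (φ (FreeGroup.mk u)) := by
    intro u
    induction u with
    | nil => intro _; simp [actW, ← FreeGroup.one_eq_mk]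
    | cons l u ih =>
      intro hv
      have h1 := ih fun v h => hv v (h.trans (List.suffix_cons l u))
      have h3 := hv u (List.suffix_cons l u)
      have h2 : FreeGroup.mk (l :: u) = FreeGroup.mk [l] * FreeGroup.mk u := by simp
      have : actW c (l :: u) (e 1) = letter c l (actW c u (e 1)) := rfl
      rw [this, h1, letter_eq, h2, map_mul]
      rcases l with ⟨a, b⟩
      cases b
      · have h4 : FreeGroup.mk [(a, false)] = (FreeGroup.of a)⁻¹ := by
          simp [FreeGroup.of, FreeGroup.inv_mk, FreeGroup.invRev]
        rw [h4, map_inv, FreeGroup.lift_apply_of, hc, Equiv.Perm.inv_eq_iff_eq, map_inv, hL]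
        · simp
        · exact Finset.mem_union_right _ (Finset.mem_image_of_mem _ h3)
      · have h4 : FreeGroup.mk [(a, true)] = FreeGroup.of a := rfl
        rw [h4, FreeGroup.lift_apply_of, hc, hL]
        exact Finset.mem_union_left _ h3
  intro u hu
  refine key u fun v hv => ?_
  simp only [V, List.mem_toFinset]
  exact List.mem_map.2 ⟨v, List.mem_flatMap.2 ⟨u, hu, (List.mem_tails _ _).2 hv⟩, rfl⟩

end

end WordProblemAux

open WordProblemAux in
/-- If a finitely presented group `⟨A;R⟩` admits `D : ℕ → ℕ` such that every
word `w` of length `≤ n` representing the identity can be written in the free group as a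
product `∏ x_i⁻¹ r_i x_i` with `r_i ∈ R ∪ R⁻¹` and all `|x_i| ≤ D(n)`, and `D` is
computable, then the word problem of `⟨A;R⟩` is decidable (there is a computable function
deciding which words represent the identity). -/
theorem stmt11 {α : Type} [Fintype α] [DecidableEq α] [Primcodable α]
    (rels : Set (FreeGroup α)) (hrels : rels.Finite)
    (D : ℕ → ℕ) (hD : Computable D)
    (hiso : ∀ (n : ℕ) (w : List (α × Bool)), w.length ≤ n →
      (QuotientGroup.mk (FreeGroup.mk w) : PresentedGroup rels) = 1 →
      ∃ L : List (FreeGroup α × List (α × Bool)),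
        (∀ p ∈ L, (p.1 ∈ rels ∨ p.1⁻¹ ∈ rels) ∧ p.2.length ≤ D n) ∧
        FreeGroup.mk w =
          (L.map fun p => (FreeGroup.mk p.2)⁻¹ * p.1 * FreeGroup.mk p.2).prod) :
    ∃ f : List (α × Bool) → Bool, Computable f ∧
      ∀ w, f w = true ↔ (QuotientGroup.mk (FreeGroup.mk w) : PresentedGroup rels) = 1 := by
  classical
  let R : List (List (α × Bool)) := hrels.toFinset.toList.map FreeGroup.toWord ++
    hrels.toFinset.toList.map fun r => FreeGroup.toWord r⁻¹
  let φ := PresentedGroup.mk rels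
  have hR : ∀ r : FreeGroup α, (r ∈ rels ∨ r⁻¹ ∈ rels) ↔ r.toWord ∈ R := by
    intro r
    simp only [R, List.mem_append, List.mem_map, Finset.mem_toList, Set.Finite.mem_toFinset]
    constructor
    · rintro (h | h)
      · exact Or.inl ⟨r, h, rfl⟩
      · exact Or.inr ⟨r⁻¹, h, by simp⟩
    · rintro (⟨s, h, e⟩ | ⟨s, h, e⟩)
      · exact Or.inl (FreeGroup.toWord_injective e ▸ h)
      · right
        rw [← FreeGroup.toWord_injective e, inv_inv]; exact h
  have hrel : ∀ r ∈ rels, φ r = 1 := fun r hr =>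
    (QuotientGroup.eq_one_iff r).2 (Subgroup.subset_normalClosure hr)
  have hR1 : ∀ u ∈ R, φ (FreeGroup.mk u) = 1 := by
    intro u hu
    simp only [R, List.mem_append, List.mem_map, Finset.mem_toList, Set.Finite.mem_toFinset] at hu
    rcases hu with ⟨s, h, rfl⟩ | ⟨s, h, rfl⟩
    · rw [FreeGroup.mk_toWord]; exact hrel s h
    · rw [FreeGroup.mk_toWord, map_inv, hrel s h, inv_one]
  have hcount : Countable (PresentedGroup rels) := by
    have : Function.Surjective fun w : List (α × Bool) => φ (FreeGroup.mk w) := by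
      intro p
      obtain ⟨g, rfl⟩ := PresentedGroup.mk_surjective rels p
      exact ⟨g.toWord, by simp only [FreeGroup.mk_toWord]; rfl⟩
    exact this.countable
  change ∃ f : List (α × Bool) → Bool, Computable f ∧ ∀ w, f w = true ↔ φ (FreeGroup.mk w) = 1
  -- positive certificates are sound
  have posSound : ∀ w L, Pos R w L → φ (FreeGroup.mk w) = 1 := by
    intro w L h
    rw [FreeGroup.reduce.exact h, mk_posWord, map_list_prod]
    refine List.prod_eq_one fun y hy => ?_
    simp only [List.map_map, List.mem_map, Function.comp] at hy
    obtain ⟨p, _, rfl⟩ := hy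
    have : φ (FreeGroup.mk (R.getD p.1 [])) = 1 := by
      by_cases hp : p.1 < R.length
      · rw [List.getD_eq_getElem _ _ hp]; exact hR1 _ (List.getElem_mem hp)
      · rw [List.getD_eq_default _ _ (not_lt.1 hp), ← FreeGroup.one_eq_mk, map_one]
    rw [map_mul, map_mul, this, map_inv, mul_one, inv_mul_cancel]
  -- positive certificates exist
  have posEx : ∀ w, φ (FreeGroup.mk w) = 1 → ∃ L, Pos R w L := by
    intro w h
    obtain ⟨L, hL, e⟩ := hiso w.length w le_rfl h
    refine ⟨L.map fun p => (R.idxOf p.1.toWord, p.2), FreeGroup.reduce.sound ?_⟩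
    rw [mk_posWord, e, List.map_map]
    congr 1
    refine List.map_congr_left fun p hp => ?_
    have hm := (hR p.1).1 (hL p hp).1
    simp only [Function.comp]
    rw [List.getD_eq_getElem _ _ (List.idxOf_lt_length_iff.2 hm), List.getElem_idxOf,
      FreeGroup.mk_toWord]
  -- negative certificates are sound
  have negSound : ∀ w c, Neg R w (D w.length) c → φ (FreeGroup.mk w) ≠ 1 := by
    rintro w c ⟨h1, h2⟩ h
    obtain ⟨L, hL, e⟩ := hiso w.length w le_rfl h
    apply h2
    rw [actW_eq, e]
    have hmem : (L.map fun p => (FreeGroup.mk p.2)⁻¹ * p.1 * FreeGroup.mk p.2).prod ∈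
        (MulAction.stabilizer (Equiv.Perm ℕ) c.1).comap (FreeGroup.lift (sig c.2)) := by
      refine Subgroup.list_prod_mem _ fun y hy => ?_
      obtain ⟨p, hp, rfl⟩ := List.mem_map.1 hy
      have h3 := h1 (p.1.toWord, p.2) (List.mem_flatMap.2 ⟨p.2, mem_words _ _ (hL p hp).2,
        List.mem_map.2 ⟨_, (hR p.1).1 (hL p hp).1, rfl⟩⟩)
      simp only [actW_eq, FreeGroup.mk_toWord] at h3
      rw [Subgroup.mem_comap, MulAction.mem_stabilizer_iff, Equiv.Perm.smul_def, map_mul, map_mul,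
        Equiv.Perm.mul_apply, Equiv.Perm.mul_apply, h3, map_inv, Equiv.Perm.inv_eq_iff_eq]
    exact hmem
  -- negative certificates exist
  have negEx : ∀ w d, φ (FreeGroup.mk w) ≠ 1 → ∃ c, Neg R w d c := by
    intro w d h
    obtain ⟨e, c, he, hc⟩ := exists_action φ
      (w :: (((rxs R d).map fun p => p.2) ++ (rxs R d).map fun p => p.1 ++ p.2))
    refine ⟨(e 1, c), fun p hp => ?_, ?_⟩
    · have h1 := hc p.2 (List.mem_cons_of_mem _ (List.mem_append_left _
        (List.mem_map.2 ⟨p, hp, rfl⟩)))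
      have h2 := hc (p.1 ++ p.2) (List.mem_cons_of_mem _ (List.mem_append_right _
        (List.mem_map.2 ⟨p, hp, rfl⟩)))
      have h3 : actW c (p.1 ++ p.2) (e 1) = actW c p.1 (actW c p.2 (e 1)) := by
        simp [actW]
      have h4 : p.1 ∈ R := by
        obtain ⟨x, _, hx⟩ := List.mem_flatMap.1 hp
        obtain ⟨r, hr, rfl⟩ := List.mem_map.1 hx
        exact hr
      change actW c p.1 (actW c p.2 (e 1)) = actW c p.2 (e 1)
      rw [← h3, h2, h1, ← FreeGroup.mul_mk, map_mul, hR1 _ h4, one_mul]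
    · change actW c w (e 1) ≠ e 1
      rw [hc w (by simp)]
      exact fun h' => h (he h')
  let F : List (α × Bool) → ℕ → Option Bool := fun w n =>
    (Encodable.decode (α := Cert α) n).bind fun c => chk R ((w, D w.length), c)
  have hF : Computable₂ F := by
    refine Computable.option_bind (Computable.decode.comp Computable.snd) ?_
    refine (primrec_chk R).to_comp.comp (Computable.pair (Computable.pair ?_ ?_) Computable.snd)
    · exact Computable.fst.comp Computable.fst
    · exact hD.comp (Computable.list_length.comp (Computable.fst.comp Computable.fst))
  have hFs : ∀ w n b, b ∈ F w n → (b = true ↔ φ (FreeGroup.mk w) = 1) := by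
    intro w n b hb
    obtain ⟨c, _, hc⟩ := Option.bind_eq_some_iff.1 hb
    simp only [chk] at hc
    split_ifs at hc with h1 h2
    · cases hc
      simpa using posSound _ _ h1
    · cases hc
      simpa using negSound _ _ h2
  have hdom : ∀ w, (Nat.rfindOpt (F w)).Dom := by
    intro w
    rw [Nat.rfindOpt_dom]
    by_cases h : φ (FreeGroup.mk w) = 1
    · obtain ⟨L, hL⟩ := posEx w h
      refine ⟨Encodable.encode ((L, (0, [])) : Cert α), true, ?_⟩
      simp only [F, Encodable.encodek, Option.bind_some, chk]
      simp [hL]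
    · obtain ⟨c, hc⟩ := negEx w (D w.length) h
      have hp : ¬ Pos R w [] := fun h' => h (posSound _ _ h')
      refine ⟨Encodable.encode (([], c) : Cert α), false, ?_⟩
      simp only [F, Encodable.encodek, Option.bind_some, chk]
      simp [hc, hp]
  refine ⟨fun w => (Nat.rfindOpt (F w)).get (hdom w), ?_, fun w => ?_⟩
  · exact (Partrec.rfindOpt hF).of_eq fun w => (Part.some_get (hdom w)).symm
  · obtain ⟨n, hn⟩ := Nat.rfindOpt_spec (Part.get_mem (hdom w))
    exact hFs w n _ hn
end

section
/- (Double exponential inequality) If P is the minimum isoperimetric function and d the minimum isodiametric function of a finite presentation ⟨A;R⟩, then for all n, P(n) ≤ n · 2^{C·c^{d(n)}}, where C = 2(2|A|+1)‖R‖² and c = (2|A|)². -/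
/-- `w` represents the identity of the group presented by `⟨A;R⟩`. -/
def WordTrivial {α : Type*} (R : Finset (List (α × Bool))) (w : List (α × Bool)) : Prop :=
  FreeGroup.mk w ∈ Subgroup.normalClosure (FreeGroup.mk '' (R : Set (List (α × Bool))))

/-- The minimum isoperimetric function of `⟨A;R⟩`: `Pmin R n` is the least `N` such that
every trivial word of length `≤ n` equals, in `FG(A)`, a product of at most `N` conjugates
of relators from `R ∪ R⁻¹`. -/
noncomputable def Pmin {α : Type*} (R : Finset (List (α × Bool))) (n : ℕ) : ℕ :=
  sInf {N | ∀ w : List (α × Bool), w.length ≤ n → WordTrivial R w →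
    ∃ L : List (List (α × Bool) × List (α × Bool)),
      (∀ p ∈ L, p.1 ∈ R ∨ FreeGroup.invRev p.1 ∈ R) ∧ L.length ≤ N ∧
      FreeGroup.mk w = (L.map fun p =>
        (FreeGroup.mk p.2)⁻¹ * FreeGroup.mk p.1 * FreeGroup.mk p.2).prod}

/-- The minimum isodiametric function of `⟨A;R⟩`: `dmin R n` is the least `D` such that
every trivial word of length `≤ n` equals, in `FG(A)`, a product of conjugates
`x_i⁻¹ r_i x_i` of relators `r_i ∈ R ∪ R⁻¹` with all `|x_i| ≤ D`. -/
noncomputable def dmin {α : Type*} (R : Finset (List (α × Bool))) (n : ℕ) : ℕ :=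
  sInf {D | ∀ w : List (α × Bool), w.length ≤ n → WordTrivial R w →
    ∃ L : List (List (α × Bool) × List (α × Bool)),
      (∀ p ∈ L, (p.1 ∈ R ∨ FreeGroup.invRev p.1 ∈ R) ∧ p.2.length ≤ D) ∧
      FreeGroup.mk w = (L.map fun p =>
        (FreeGroup.mk p.2)⁻¹ * FreeGroup.mk p.1 * FreeGroup.mk p.2).prod}

/-- `g` is a product of at most `N` conjugates of relators. -/
def AreaLE {α : Type} (R : Finset (List (α × Bool))) (g : FreeGroup α) (N : ℕ) : Prop :=
  ∃ L : List (List (α × Bool) × List (α × Bool)),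
      (∀ p ∈ L, p.1 ∈ R ∨ FreeGroup.invRev p.1 ∈ R) ∧ L.length ≤ N ∧
      g = (L.map fun p =>
        (FreeGroup.mk p.2)⁻¹ * FreeGroup.mk p.1 * FreeGroup.mk p.2).prod

namespace AreaLE
variable {α : Type} {R : Finset (List (α × Bool))}

lemma one (N : ℕ) : AreaLE R 1 N := ⟨[], by simp, by simp, by simp⟩

lemma mono {g : FreeGroup α} {N M : ℕ} (h : AreaLE R g N) (hNM : N ≤ M) : AreaLE R g M := by
  obtain ⟨L, h1, h2, h3⟩ := h
  exact ⟨L, h1, h2.trans hNM, h3⟩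

lemma mul {g h : FreeGroup α} {N M : ℕ} (hg : AreaLE R g N) (hh : AreaLE R h M) :
    AreaLE R (g * h) (N + M) := by
  obtain ⟨L, h1, h2, h3⟩ := hg
  obtain ⟨L', h1', h2', h3'⟩ := hh
  refine ⟨L ++ L', ?_, ?_, ?_⟩
  · intro p hp
    rcases List.mem_append.1 hp with hp | hp
    · exact h1 p hp
    · exact h1' p hp
  · simp only [List.length_append]; omega
  · rw [List.map_append, List.prod_append, ← h3, ← h3']

lemma single {r : List (α × Bool)} (hr : r ∈ R ∨ FreeGroup.invRev r ∈ R) (x : FreeGroup α) :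
    AreaLE R (x⁻¹ * FreeGroup.mk r * x) 1 := by
  obtain ⟨x, rfl⟩ : ∃ y, FreeGroup.mk y = x := Quot.exists_rep x
  exact ⟨[(r, x)], by simpa using hr, by simp, by simp⟩

lemma inv {g : FreeGroup α} {N : ℕ} (hg : AreaLE R g N) : AreaLE R g⁻¹ N := by
  obtain ⟨L, h1, h2, rfl⟩ := hg
  induction L generalizing N with
  | nil => simpa using one N
  | cons p L ih =>
    simp only [List.length_cons] at h2
    rw [List.map_cons, List.prod_cons, mul_inv_rev]
    have a := ih (N := N - 1) (fun q hq => h1 q (List.mem_cons_of_mem _ hq)) (by omega)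
    have b : AreaLE R ((FreeGroup.mk p.2)⁻¹ * FreeGroup.mk p.1 * FreeGroup.mk p.2)⁻¹ 1 := by
      have := single (R := R) (r := FreeGroup.invRev p.1)
        (by rw [FreeGroup.invRev_invRev]; exact (h1 p (by simp)).symm) (FreeGroup.mk p.2)
      rw [← FreeGroup.inv_mk] at this
      convert this using 1
      group
    exact (a.mul b).mono (by omega)

lemma exists_of_mem {g : FreeGroup α}
    (hg : g ∈ Subgroup.normalClosure (FreeGroup.mk '' (R : Set (List (α × Bool))))) :
    ∃ N, AreaLE R g N := by
  unfold Subgroup.normalClosure at hg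
  induction hg using Subgroup.closure_induction with
  | mem x hx =>
    rw [Group.mem_conjugatesOfSet_iff] at hx
    obtain ⟨_, ⟨r, hr, rfl⟩, hx⟩ := hx
    obtain ⟨c, rfl⟩ := isConj_iff.1 hx
    exact ⟨1, by simpa using single (R := R) (Or.inl hr) c⁻¹⟩
  | one => exact ⟨0, one 0⟩
  | mul x y _ _ hx hy =>
    obtain ⟨N, hN⟩ := hx
    obtain ⟨M, hM⟩ := hy
    exact ⟨_, hN.mul hM⟩
  | inv x _ hx =>
    obtain ⟨N, hN⟩ := hx
    exact ⟨_, hN.inv⟩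
end AreaLE

lemma dmin_spec {α : Type} [Fintype α] (R : Finset (List (α × Bool))) (n : ℕ) :
    ∀ w : List (α × Bool), w.length ≤ n → WordTrivial R w →
    ∃ L : List (List (α × Bool) × List (α × Bool)),
      (∀ p ∈ L, (p.1 ∈ R ∨ FreeGroup.invRev p.1 ∈ R) ∧ p.2.length ≤ dmin R n) ∧
      FreeGroup.mk w = (L.map fun p =>
        (FreeGroup.mk p.2)⁻¹ * FreeGroup.mk p.1 * FreeGroup.mk p.2).prod := by
  refine Nat.sInf_mem (s := {D | ∀ w : List (α × Bool), w.length ≤ n → WordTrivial R w →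
    ∃ L : List (List (α × Bool) × List (α × Bool)),
      (∀ p ∈ L, (p.1 ∈ R ∨ FreeGroup.invRev p.1 ∈ R) ∧ p.2.length ≤ D) ∧
      FreeGroup.mk w = (L.map fun p =>
        (FreeGroup.mk p.2)⁻¹ * FreeGroup.mk p.1 * FreeGroup.mk p.2).prod}) ?_
  have h1 : ∀ w : List (α × Bool), ∃ D, WordTrivial R w →
    ∃ L : List (List (α × Bool) × List (α × Bool)),
      (∀ p ∈ L, (p.1 ∈ R ∨ FreeGroup.invRev p.1 ∈ R) ∧ p.2.length ≤ D) ∧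
      FreeGroup.mk w = (L.map fun p =>
        (FreeGroup.mk p.2)⁻¹ * FreeGroup.mk p.1 * FreeGroup.mk p.2).prod := by
    intro w
    by_cases hw : WordTrivial R w
    · obtain ⟨N, L, hL, -, hp⟩ := AreaLE.exists_of_mem hw
      refine ⟨(L.map fun p => p.2.length).sum, fun _ => ⟨L, fun p hpL => ⟨hL p hpL, ?_⟩, hp⟩⟩
      exact List.le_sum_of_mem (List.mem_map.2 ⟨p, hpL, rfl⟩)
    · exact ⟨0, fun h => absurd h hw⟩
  choose D hD using h1
  have hfin := List.finite_length_le (α × Bool) n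
  obtain ⟨B, hB⟩ := (hfin.image D).bddAbove
  refine ⟨B, fun w hw ht => ?_⟩
  obtain ⟨L, hL, hp⟩ := hD w ht
  exact ⟨L, fun p hpL => ⟨(hL p hpL).1, (hL p hpL).2.trans (hB ⟨w, hw, rfl⟩)⟩, hp⟩

/-- Reading a word in the quotient graph of `V` by the colouring `f`. -/
def Reads {α : Type} (V : Finset (FreeGroup α)) (f : FreeGroup α → FreeGroup α) :
    FreeGroup α → List (α × Bool) → FreeGroup α → Prop
  | p, [], q => p = q
  | p, a :: w, q => ∃ u ∈ V, u * FreeGroup.mk [a] ∈ V ∧ f u = p ∧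
      Reads V f (f (u * FreeGroup.mk [a])) w q

/-- The quotient graph is folded. -/
def Folded {α : Type} (V : Finset (FreeGroup α)) (f : FreeGroup α → FreeGroup α) : Prop :=
  ∀ u v : FreeGroup α, ∀ a : α × Bool, u ∈ V → v ∈ V → u * FreeGroup.mk [a] ∈ V →
    v * FreeGroup.mk [a] ∈ V → f u = f v → f (u * FreeGroup.mk [a]) = f (v * FreeGroup.mk [a])

section reads
variable {α : Type} {V : Finset (FreeGroup α)} {f : FreeGroup α → FreeGroup α}

lemma mk_letter_cancel (u : FreeGroup α) (x : α) (b : Bool) :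
    u * FreeGroup.mk [(x, b)] * FreeGroup.mk [(x, !b)] = u := by
  have : FreeGroup.mk [(x, !b)] = (FreeGroup.mk [(x, b)])⁻¹ := by
    simp [FreeGroup.inv_mk, FreeGroup.invRev]
  rw [this]; group

lemma reads_append (p q : FreeGroup α) (w₁ w₂ : List (α × Bool)) :
    Reads V f p (w₁ ++ w₂) q ↔ ∃ m, Reads V f p w₁ m ∧ Reads V f m w₂ q := by
  induction w₁ generalizing p with
  | nil => simp [Reads]
  | cons a w ih =>
    simp only [List.cons_append, Reads, ih]
    constructor
    · rintro ⟨u, h1, h2, h3, m, h4, h5⟩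
      exact ⟨m, ⟨u, h1, h2, h3, h4⟩, h5⟩
    · rintro ⟨m, ⟨u, h1, h2, h3, h4⟩, h5⟩
      exact ⟨u, h1, h2, h3, m, h4, h5⟩

lemma reads_step (hf : Folded V f) {p q : FreeGroup α} {w w' : List (α × Bool)}
    (h : FreeGroup.Red.Step w w') (hw : Reads V f p w q) : Reads V f p w' q := by
  cases h with
  | @not L₁ L₂ x b =>
    rw [reads_append] at hw ⊢
    obtain ⟨m, h1, h2⟩ := hw
    refine ⟨m, h1, ?_⟩
    obtain ⟨u, hu, hua, rfl, v, hv, hva, hvu, h3⟩ := h2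
    have := hf _ _ (x, !b) hv hua hva (by rw [mk_letter_cancel]; exact hu) hvu
    rw [mk_letter_cancel] at this
    rwa [this] at h3

lemma reads_red (hf : Folded V f) {p q : FreeGroup α} {w w' : List (α × Bool)}
    (h : FreeGroup.Red w w') (hw : Reads V f p w q) : Reads V f p w' q := by
  induction h with
  | refl => exact hw
  | tail _ h ih => exact reads_step hf h ih

lemma reads_inv {p q : FreeGroup α} {w : List (α × Bool)}
    (h : Reads V f p w q) : Reads V f q (FreeGroup.invRev w) p := by
  induction w generalizing p with
  | nil => exact Eq.symm h
  | cons a w ih =>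
    obtain ⟨u, hu, hua, rfl, h3⟩ := h
    have : FreeGroup.invRev (a :: w) = FreeGroup.invRev w ++ [(a.1, !a.2)] := by
      simp [FreeGroup.invRev]
    rw [this, reads_append]
    refine ⟨_, ih h3, _, hua, ?_, rfl, ?_⟩
    · rw [mk_letter_cancel u a.1 a.2]; exact hu
    · rw [mk_letter_cancel u a.1 a.2]; rfl

lemma reads_path (g : FreeGroup α) (w : List (α × Bool))
    (h : ∀ w₁ w₂, w = w₁ ++ w₂ → g * FreeGroup.mk w₁ ∈ V) :
    Reads V f (f g) w (f (g * FreeGroup.mk w)) := by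
  induction w generalizing g with
  | nil => simp [Reads, ← FreeGroup.one_eq_mk]
  | cons a w ih =>
    have e : ∀ w', g * FreeGroup.mk (a :: w') = g * FreeGroup.mk [a] * FreeGroup.mk w' := by
      intro w'; rw [mul_assoc, FreeGroup.mul_mk]; rfl
    refine ⟨g, ?_, h [a] w rfl, rfl, ?_⟩
    · simpa [← FreeGroup.one_eq_mk] using h [] _ rfl
    · rw [e w]
      apply ih
      rintro w₁ w₂ rfl
      rw [← e]
      exact h _ w₂ rfl

lemma reads_area {R : Finset (List (α × Bool))} {M : ℕ}
    (hM : ∀ u ∈ V, ∀ v ∈ V, f u = f v → AreaLE R (u * v⁻¹) M)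
    (w : List (α × Bool)) (p q u : FreeGroup α) (hu : u ∈ V) (hup : f u = p)
    (h : Reads V f p w q) :
    ∃ v ∈ V, f v = q ∧ AreaLE R (u * FreeGroup.mk w * v⁻¹) (w.length * M) := by
  induction w generalizing p u with
  | nil =>
    refine ⟨u, hu, hup.trans h, ?_⟩
    simpa [← FreeGroup.one_eq_mk] using AreaLE.one 0
  | cons a w ih =>
    obtain ⟨u', hu', hua, h2, h3⟩ := h
    obtain ⟨v, hv, hvq, hA⟩ := ih _ _ hua rfl h3
    refine ⟨v, hv, hvq, ?_⟩
    have := (hM u hu u' hu' (hup.trans h2.symm)).mul hA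
    have e : FreeGroup.mk (a :: w) = FreeGroup.mk [a] * FreeGroup.mk w := by
      rw [FreeGroup.mul_mk]; rfl
    convert this using 1
    · rw [e]; group
    · simp only [List.length_cons]; ring
end reads

/-- The folding process. -/
lemma exists_folded {α : Type} [DecidableEq α] (R : Finset (List (α × Bool)))
    (V : Finset (FreeGroup α))
    (S : FreeGroup α → FreeGroup α → Prop) (hS : ∀ u v, S u v → AreaLE R (u * v⁻¹) 1)
    (k : ℕ) : ∀ (f : FreeGroup α → FreeGroup α) (c : ℕ), 1 ≤ c → (V.image f).card ≤ k →
    (∀ u ∈ V, ∀ v ∈ V, f u = f v → AreaLE R (u * v⁻¹) c) →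
    ∃ f' : FreeGroup α → FreeGroup α, Folded V f' ∧
      (∀ u ∈ V, ∀ v ∈ V, S u v → f' u = f' v) ∧
      (∀ u ∈ V, ∀ v ∈ V, f' u = f' v → AreaLE R (u * v⁻¹) (c * 3 ^ k)) := by
  induction k with
  | zero =>
    intro f c _ hk hc
    have hV : V = ∅ := by simpa using hk
    subst hV
    exact ⟨f, by intro u v a hu; simp at hu, by simp, by simp⟩
  | succ k ih =>
    intro f c hc1 hk hc
    by_cases hbad : ∃ u ∈ V, ∃ v ∈ V, f u ≠ f v ∧ AreaLE R (u * v⁻¹) c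
    · obtain ⟨u, hu, v, hv, hne, hA⟩ := hbad
      let f₁ : FreeGroup α → FreeGroup α := fun x => if f x = f v then f u else f x
      have hcard : (V.image f₁).card ≤ k := by
        have hsub : V.image f₁ ⊆ (V.image f).erase (f v) := by
          intro y hy
          obtain ⟨x, hx, rfl⟩ := Finset.mem_image.1 hy
          rw [Finset.mem_erase]
          by_cases hxv : f x = f v
          · simp only [f₁, hxv, if_true]
            exact ⟨hne, Finset.mem_image_of_mem _ hu⟩
          · simp only [f₁, hxv, if_false]
            exact ⟨hxv, Finset.mem_image_of_mem _ hx⟩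
        have := Finset.card_le_card hsub
        rw [Finset.card_erase_of_mem (Finset.mem_image_of_mem _ hv)] at this
        omega
      have key : ∀ x ∈ V, ∀ y ∈ V, f x = f u → f y = f v → AreaLE R (x * y⁻¹) (c * 3) := by
        intro x hx y hy hxu hyv
        have := ((hc x hx u hu hxu).mul hA).mul (hc v hv y hy hyv.symm)
        convert this using 1
        · group
        · ring
      obtain ⟨f', h1, h2, h3⟩ := ih f₁ (c * 3) (by omega) hcard (by
        intro x hx y hy hxy
        by_cases hxv : f x = f v <;> by_cases hyv : f y = f v
        · exact (hc x hx y hy (hxv.trans hyv.symm)).mono (by omega)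
        · simp only [f₁, hxv, hyv, if_true, if_false] at hxy
          have := (key y hy x hx hxy.symm hxv).inv
          simpa using this
        · simp only [f₁, hxv, hyv, if_true, if_false] at hxy
          exact key x hx y hy hxy hyv
        · simp only [f₁, hxv, hyv, if_false] at hxy
          exact (hc x hx y hy hxy).mono (by omega))
      refine ⟨f', h1, h2, fun u hu v hv h => ?_⟩
      have := h3 u hu v hv h
      rwa [mul_assoc, ← pow_succ'] at this
    · push Not at hbad
      refine ⟨f, ?_, ?_, ?_⟩
      · intro u v a hu hv hua hva huv
        by_contra hne
        refine hbad _ hua _ hva hne ?_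
        have := hc u hu v hv huv
        convert this using 1
        group
      · intro u hu v hv hs
        by_contra hne
        exact hbad u hu v hv hne ((hS u v hs).mono hc1)
      · intro u hu v hv h
        exact (hc u hu v hv h).mono (Nat.le_mul_of_pos_right _ (by positivity))

/-- The words of length at most `D`. -/
def wordBall (α : Type) [Fintype α] [DecidableEq α] : ℕ → Finset (List (α × Bool))
  | 0 => {[]}
  | D + 1 => insert [] ((Finset.univ ×ˢ wordBall α D).image fun p => p.1 :: p.2)

lemma mem_wordBall {α : Type} [Fintype α] [DecidableEq α] (D : ℕ) (w : List (α × Bool))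
    (h : w.length ≤ D) : w ∈ wordBall α D := by
  induction D generalizing w with
  | zero =>
    have : w = [] := by simpa using h
    simp [wordBall, this]
  | succ D ih =>
    cases w with
    | nil => simp [wordBall]
    | cons a w =>
      rw [wordBall, Finset.mem_insert, Finset.mem_image]
      refine Or.inr ⟨(a, w), ?_, rfl⟩
      simp only [Finset.mem_product, Finset.mem_univ, true_and]
      exact ih w (by simpa using h)

lemma card_wordBall {α : Type} [Fintype α] [DecidableEq α] (ha : 1 ≤ Fintype.card α) (D : ℕ) :
    (wordBall α D).card + 1 ≤ 2 * (2 * Fintype.card α) ^ D := by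
  induction D with
  | zero => simp [wordBall]
  | succ D ih =>
    have h1 : (wordBall α (D + 1)).card ≤ 2 * Fintype.card α * (wordBall α D).card + 1 := by
      refine (Finset.card_insert_le _ _).trans (Nat.add_le_add_right ?_ 1)
      refine Finset.card_image_le.trans ?_
      rw [Finset.card_product]
      simp [Fintype.card_prod, mul_comm]
    rw [pow_succ]
    nlinarith

/-- The prefixes of the relators. -/
def relPrefixes {α : Type} [DecidableEq α] (R : Finset (List (α × Bool))) :
    Finset (List (α × Bool)) :=
  insert [] (R.biUnion fun r => (Finset.Icc 1 r.length).image fun i => r.take i)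

lemma card_relPrefixes {α : Type} [DecidableEq α] (R : Finset (List (α × Bool))) :
    (relPrefixes R).card ≤ (∑ r ∈ R, r.length) + 1 := by
  refine (Finset.card_insert_le _ _).trans (Nat.add_le_add_right ?_ 1)
  refine Finset.card_biUnion_le.trans (Finset.sum_le_sum fun r _ => ?_)
  exact Finset.card_image_le.trans (by simp)

lemma mem_relPrefixes {α : Type} [DecidableEq α] (R : Finset (List (α × Bool)))
    (w₁ w₂ : List (α × Bool)) (h : w₁ ++ w₂ ∈ R) : w₁ ∈ relPrefixes R := by
  rw [relPrefixes, Finset.mem_insert]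
  by_cases hw : w₁ = []
  · exact Or.inl hw
  · refine Or.inr (Finset.mem_biUnion.2 ⟨_, h, Finset.mem_image.2 ⟨w₁.length, ?_, by simp⟩⟩)
    have := List.length_pos_iff.2 hw
    simp only [Finset.mem_Icc, List.length_append]
    omega

lemma area_bound {α : Type} [Fintype α] [DecidableEq α]
    (R : Finset (List (α × Bool))) (D : ℕ) (w : List (α × Bool))
    (L : List (List (α × Bool) × List (α × Bool)))
    (hL : ∀ p ∈ L, (p.1 ∈ R ∨ FreeGroup.invRev p.1 ∈ R) ∧ p.2.length ≤ D)
    (hw : FreeGroup.mk w = (L.map fun p =>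
        (FreeGroup.mk p.2)⁻¹ * FreeGroup.mk p.1 * FreeGroup.mk p.2).prod) :
    AreaLE R (FreeGroup.mk w)
      ((w.length + 1) * 3 ^ ((wordBall α D).card * (relPrefixes R).card)) := by
  let V : Finset (FreeGroup α) := (wordBall α D ×ˢ relPrefixes R).image
    fun p => FreeGroup.mk p.1 * FreeGroup.mk p.2
  have hVcard : V.card ≤ (wordBall α D).card * (relPrefixes R).card := by
    refine Finset.card_image_le.trans ?_
    rw [Finset.card_product]
  have hmemV : ∀ x p : List (α × Bool), x.length ≤ D → p ∈ relPrefixes R →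
      FreeGroup.mk x * FreeGroup.mk p ∈ V := fun x p hx hp =>
    Finset.mem_image.2 ⟨(x, p), Finset.mem_product.2 ⟨mem_wordBall D x hx, hp⟩, rfl⟩
  have hnil : [] ∈ relPrefixes R := by simp [relPrefixes]
  have hmemV' : ∀ x : List (α × Bool), x.length ≤ D → FreeGroup.mk x ∈ V := fun x hx => by
    simpa [← FreeGroup.one_eq_mk] using hmemV x [] hx hnil
  have h1V : (1 : FreeGroup α) ∈ V := by
    have := hmemV' [] (by simp)
    rwa [← FreeGroup.one_eq_mk] at this
  let S : FreeGroup α → FreeGroup α → Prop := fun u v => ∃ r ∈ R, u = v * FreeGroup.mk r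
  obtain ⟨f, hf, hfS, hfA⟩ := exists_folded R V S (by
    rintro u v ⟨r, hr, rfl⟩
    simpa using AreaLE.single (R := R) (Or.inl hr) v⁻¹)
    ((wordBall α D).card * (relPrefixes R).card) id 1 le_rfl (by simpa using hVcard) (by
      intro u _ v _ h
      simp only [id] at h
      subst h
      simpa using AreaLE.one 1)
  rw [one_mul] at hfA
  set M := 3 ^ ((wordBall α D).card * (relPrefixes R).card) with hMdef
  have hloop : ∀ r ∈ R, ∀ x : List (α × Bool), x.length ≤ D →
      Reads V f (f (FreeGroup.mk x)) r (f (FreeGroup.mk x)) := by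
    intro r hr x hx
    have h1 := reads_path (V := V) (f := f) (FreeGroup.mk x) r (by
      intro w₁ w₂ hw
      exact hmemV x w₁ hx (mem_relPrefixes R w₁ w₂ (hw ▸ hr)))
    rwa [hfS _ (hmemV x r hx (mem_relPrefixes R r [] (by simpa using hr))) _ (hmemV' x hx)
      ⟨r, hr, rfl⟩] at h1
  have hloop' : ∀ r, (r ∈ R ∨ FreeGroup.invRev r ∈ R) → ∀ x : List (α × Bool), x.length ≤ D →
      Reads V f (f (FreeGroup.mk x)) r (f (FreeGroup.mk x)) := by
    rintro r (hr | hr) x hx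
    · exact hloop r hr x hx
    · have := reads_inv (hloop _ hr x hx)
      rwa [FreeGroup.invRev_invRev] at this
  have hpath : ∀ x : List (α × Bool), x.length ≤ D →
      Reads V f (f 1) x (f (FreeGroup.mk x)) := by
    intro x hx
    have := reads_path (V := V) (f := f) 1 x (by
      rintro w₁ w₂ rfl
      rw [one_mul]
      exact hmemV' w₁ (by simp only [List.length_append] at hx; omega))
    rwa [one_mul] at this
  have hread : ∃ W, FreeGroup.mk W = FreeGroup.mk w ∧ Reads V f (f 1) W (f 1) := by
    rw [hw]
    clear hw
    induction L with
    | nil => exact ⟨[], by simp [FreeGroup.one_eq_mk], rfl⟩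
    | cons p L ih =>
      obtain ⟨W, hW, hR⟩ := ih fun q hq => hL q (List.mem_cons_of_mem _ hq)
      obtain ⟨hp1, hp2⟩ := hL p (by simp)
      have hlen : (FreeGroup.invRev p.2).length ≤ D := by simpa using hp2
      refine ⟨(FreeGroup.invRev p.2 ++ p.1 ++ p.2) ++ W, ?_, ?_⟩
      · rw [List.map_cons, List.prod_cons, ← hW, FreeGroup.inv_mk, FreeGroup.mul_mk,
          FreeGroup.mul_mk, FreeGroup.mul_mk]
      · rw [reads_append]
        refine ⟨f 1, ?_, hR⟩
        rw [reads_append]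
        refine ⟨f (FreeGroup.mk (FreeGroup.invRev p.2)), ?_, ?_⟩
        · rw [reads_append]
          exact ⟨_, hpath _ hlen, hloop' _ hp1 _ hlen⟩
        · have := reads_inv (hpath _ hlen)
          rwa [FreeGroup.invRev_invRev] at this
  obtain ⟨W, hW, hR⟩ := hread
  have hred := reads_red hf (FreeGroup.reduce.red (L := W)) hR
  obtain ⟨v, hv, hv1, hA⟩ := reads_area hfA _ _ _ 1 h1V rfl hred
  have hlen : (FreeGroup.reduce W).length ≤ w.length := by
    rw [FreeGroup.reduce.sound hW]
    exact (FreeGroup.reduce.red (L := w)).length_le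
  have h2 := hA.mul (hfA v hv 1 h1V hv1)
  have h3 : FreeGroup.mk (FreeGroup.reduce W) = FreeGroup.mk w := by
    rw [← hW]; exact FreeGroup.reduce.self
  rw [h3] at h2
  have h4 : AreaLE R (FreeGroup.mk w) ((FreeGroup.reduce W).length * M + M) := by
    convert h2 using 1
    group
  refine h4.mono ?_
  rw [add_mul, one_mul]
  gcongr

lemma final_arith (n q X l b p : ℕ) (hn : 1 ≤ n) (hq : 2 ≤ q) (hX : 1 ≤ X) (hl : 1 ≤ l)
    (hb : b + 1 ≤ 2 * X) (hp : p ≤ l + 1) :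
    (n + 1) * 3 ^ (b * p) ≤ n * 2 ^ (2 * (q + 1) * l ^ 2 * X ^ 2) := by
  have h1 : 3 ^ (b * p) ≤ 2 ^ (2 * (b * p)) := by
    rw [pow_mul 2 2]; exact Nat.pow_le_pow_left (by norm_num) _
  have hbp : b * p ≤ (2 * X - 1) * (2 * l) := by
    apply Nat.mul_le_mul <;> omega
  have h2 : 2 * (b * p) + 1 ≤ 2 * (q + 1) * l ^ 2 * X ^ 2 := by
    have h3 : 2 * (2 + 1) * l ^ 2 * X ^ 2 ≤ 2 * (q + 1) * l ^ 2 * X ^ 2 := by gcongr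
    refine le_trans ?_ h3
    obtain ⟨Y, rfl⟩ : ∃ Y, X = Y + 1 := ⟨X - 1, by omega⟩
    obtain ⟨m, rfl⟩ : ∃ m, l = m + 1 := ⟨l - 1, by omega⟩
    have e : 2 * (Y + 1) - 1 = 2 * Y + 1 := by omega
    rw [e] at hbp
    have h5 : 2 * ((2 * Y + 1) * (2 * (m + 1))) + 1 ≤
        2 * (2 + 1) * (m + 1) ^ 2 * (Y + 1) ^ 2 := by
      ring_nf
      nlinarith [Nat.zero_le (m * Y), Nat.zero_le (m ^ 2 * Y), Nat.zero_le (m * Y ^ 2),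
        Nat.zero_le (m ^ 2 * Y ^ 2), Nat.zero_le (m ^ 2), Nat.zero_le (Y ^ 2)]
    omega
  calc (n + 1) * 3 ^ (b * p) ≤ (2 * n) * 2 ^ (2 * (b * p)) := Nat.mul_le_mul (by omega) h1
    _ = n * 2 ^ (2 * (b * p) + 1) := by rw [pow_succ]; ring
    _ ≤ _ := Nat.mul_le_mul le_rfl (Nat.pow_le_pow_right (by norm_num) h2)

/-- Double exponential inequality: If `P` is the minimum isoperimetric
function and `d` the minimum isodiametric function of a finite presentation `⟨A;R⟩`, then
for all `n`, `P(n) ≤ n · 2^{C·c^{d(n)}}`, where `C = 2(2|A|+1)‖R‖²` and `c = (2|A|)²`. -/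
theorem stmt15 {α : Type} [Fintype α] [DecidableEq α]
    (R : Finset (List (α × Bool))) (hr : ∀ r ∈ R, r ≠ []) (n : ℕ) :
    Pmin R n ≤
      n * 2 ^ (2 * (2 * Fintype.card α + 1) * (∑ r ∈ R, r.length) ^ 2 *
        ((2 * Fintype.card α) ^ 2) ^ (dmin R n)) := by
  refine Nat.sInf_le ?_
  intro w hw ht
  obtain ⟨L, hL, hprod⟩ := dmin_spec R n w hw ht
  change AreaLE R (FreeGroup.mk w) _
  rcases R.eq_empty_or_nonempty with rfl | ⟨r, hrR⟩
  · have hLnil : L = [] := by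
      cases L with
      | nil => rfl
      | cons p L => simpa using (hL p (by simp)).1
    rw [hprod, hLnil]
    exact AreaLE.one _
  cases w with
  | nil =>
    rw [← FreeGroup.one_eq_mk]
    exact AreaLE.one _
  | cons a w =>
    have hcard : 1 ≤ Fintype.card α := Fintype.card_pos_iff.2 ⟨a.1⟩
    have hl : 1 ≤ ∑ r ∈ R, r.length :=
      (List.length_pos_iff.2 (hr r hrR)).trans_le
        (Finset.single_le_sum (f := fun r => r.length) (fun _ _ => Nat.zero_le _) hrR)
    refine (area_bound R (dmin R n) _ L hL hprod).mono ?_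
    refine (Nat.mul_le_mul_right _ (Nat.add_le_add_right hw 1)).trans ?_
    rw [pow_right_comm (2 * Fintype.card α) 2 (dmin R n)]
    refine final_arith n (2 * Fintype.card α) _ _ _ _ ?_ (by omega) ?_ hl (card_wordBall hcard _)
      (card_relPrefixes R)
    · simp only [List.length_cons] at hw; omega
    · exact Nat.one_le_pow _ _ (by omega)
end

section
/- (Linear compression of the isoperimetric function) If a group G has a finite presentation with isoperimetric function at most P(·), then G also has a finite presentation whose isoperimetric function is at most n ↦ P(n)/2 + n/2. -/
/-- `⟨A;R⟩` (with `A = α` finite) is a presentation of the group `G`. -/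
def IsFinPresentationOf (G : Type*) [Group G] {α : Type*}
    (R : Finset (List (α × Bool))) : Prop :=
  Nonempty (PresentedGroup (FreeGroup.mk '' (R : Set (List (α × Bool)))) ≃* G)

/-- Formal inverse of a letter. -/
def ivl {α : Type} (x : α × Bool) : α × Bool := (x.1, !x.2)

theorem ivl_ivl {α : Type} (x : α × Bool) : ivl (ivl x) = x := by
  simp [ivl]

/-- Combinatorial diagram predicate: `w` bounds a diagram with at most `k` faces. -/
inductive Dg {α : Type} (Y : Set (List (α × Bool))) : List (α × Bool) → ℕ → Prop
  | nil (k : ℕ) : Dg Y [] k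
  | pair (a : α × Bool) (u v : List (α × Bool)) (i j : ℕ) :
      Dg Y u i → Dg Y v j → Dg Y (a :: (u ++ ivl a :: v)) (i + j)
  | face (a : α × Bool) (s w : List (α × Bool)) (k : ℕ) :
      (ivl a :: s) ∈ Y → Dg Y (s ++ w) k → Dg Y (a :: w) (k + 1)

section DgLemmas
variable {α : Type} {Y : Set (List (α × Bool))}

theorem Dg.mono {w : List (α × Bool)} {k : ℕ} (h : Dg Y w k) : ∀ l, k ≤ l → Dg Y w l := by
  induction h with
  | nil k => intro l _; exact Dg.nil l
  | pair a u v i j _ hv ihu ihv =>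
    intro l hl
    have := Dg.pair a u v (l - j) j (ihu (l - j) (by omega)) hv
    rwa [show l - j + j = l by omega] at this
  | face a s w k hs _ ih =>
    intro l hl
    have := Dg.face a s w (l - 1) hs (ih (l - 1) (by omega))
    rwa [show l - 1 + 1 = l by omega] at this

theorem Dg.append {u w : List (α × Bool)} {j k : ℕ} (hu : Dg Y u j) (hw : Dg Y w k) :
    Dg Y (u ++ w) (j + k) := by
  induction hu with
  | nil j => exact hw.mono _ (by omega)
  | pair a u v i j hu hv ihu ihv =>
    have := Dg.pair a u (v ++ w) i (j + k) hu ihv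
    simpa [add_assoc] using this
  | face a s w' k' hs _ ih =>
    have := Dg.face a s (w' ++ w) (k' + k) hs (by simpa using ih)
    simpa [add_assoc, add_comm, add_left_comm] using this

theorem Dg.insert {u w : List (α × Bool)} {j k : ℕ} (hu : Dg Y u j) (hw : Dg Y w k) :
    ∀ x y, w = x ++ y → Dg Y (x ++ u ++ y) (k + j) := by
  induction hw with
  | nil k =>
    intro x y h
    obtain ⟨rfl, rfl⟩ := List.append_eq_nil_iff.1 h.symm
    simpa using hu.mono _ (by omega)
  | pair a u' v i l hu' hv ihu ihv =>
    intro x y h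
    cases x with
    | nil =>
      have h' : a :: (u' ++ ivl a :: v) = y := by simpa using h
      subst h'
      have := Dg.append hu (Dg.pair a u' v i l hu' hv)
      simpa [add_comm, add_left_comm] using this
    | cons b x =>
      rw [List.cons_append, List.cons.injEq] at h
      obtain ⟨rfl, h⟩ := h
      rcases List.append_eq_append_iff.1 h with ⟨t, rfl, ht⟩ | ⟨t, rfl, ht⟩
      · cases t with
        | nil =>
          have ht' : ivl a :: v = y := by simpa using ht
          subst ht'
          have := Dg.pair a _ v _ l (ihu u' [] (by simp)) hv
          exact (by simpa using this : Dg Y _ _).mono _ (by omega)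
        | cons c t =>
          rw [List.cons_append, List.cons.injEq] at ht
          obtain ⟨rfl, ht⟩ := ht
          have := Dg.pair a _ _ _ _ hu' (ihv t y ht)
          exact (by simpa using this : Dg Y _ _).mono _ (by omega)
      · subst ht
        have := Dg.pair a _ _ _ _ (ihu x t rfl) hv
        exact (by simpa using this : Dg Y _ _).mono _ (by omega)
  | face a s w' k' hs hw' ih =>
    intro x y h
    cases x with
    | nil =>
      have h' : a :: w' = y := by simpa using h
      subst h'
      have := Dg.append hu (Dg.face a s w' k' hs hw')
      simpa [add_comm, add_left_comm] using this
    | cons b x =>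
      rw [List.cons_append, List.cons.injEq] at h
      obtain ⟨rfl, rfl⟩ := h
      have := Dg.face a s _ _ hs (by simpa using ih (s ++ x) y (by simp))
      exact (by simpa using this : Dg Y _ _).mono _ (by omega)

/-- Face replacement at an arbitrary position, given rotation invariance up to level `K`. -/
theorem Dg.weak (hrot : ∀ a b : List (α × Bool), a ++ b ∈ Y → b ++ a ∈ Y) (K : ℕ)
    (hC : ∀ k ≤ K, ∀ w₁ w₂ : List (α × Bool), Dg Y (w₁ ++ w₂) k → Dg Y (w₂ ++ w₁) k)
    {w : List (α × Bool)} {k : ℕ} (hw : Dg Y w k) :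
    ∀ (x s y : List (α × Bool)) (b : α × Bool), k ≤ K → (ivl b :: s) ∈ Y →
      w = x ++ (s ++ y) → Dg Y (x ++ b :: y) (k + 1) := by
  induction hw with
  | nil k =>
    intro x s y b hk hb h
    have h' := h.symm
    simp only [List.append_eq_nil_iff] at h'
    obtain ⟨rfl, rfl, rfl⟩ := h'
    exact Dg.face b [] [] k hb (Dg.nil k)
  | pair c u v i j hu hv ihu ihv =>
    intro x s y b hk hb h
    cases x with
    | nil =>
      have h' : c :: (u ++ ivl c :: v) = s ++ y := by simpa using h
      exact Dg.face b s y _ hb (h' ▸ Dg.pair c u v i j hu hv)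
    | cons d x =>
      rw [List.cons_append, List.cons.injEq] at h
      obtain ⟨rfl, h⟩ := h
      rcases List.append_eq_append_iff.1 h with ⟨t, rfl, ht⟩ | ⟨t, rfl, ht⟩
      · cases t with
        | nil =>
          cases s with
          | nil =>
            have ht' : ivl c :: v = y := by simpa using ht
            subst ht'
            have := Dg.pair c _ v _ j (ihu u [] [] b (by omega) hb (by simp)) hv
            exact (by simpa using this : Dg Y _ _).mono _ (by omega)
          | cons e s =>
            have ht' : ivl c = e ∧ v = s ++ y := by simpa using ht
            obtain ⟨rfl, rfl⟩ := ht'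
            have h1 : Dg Y (ivl b :: (u ++ ivl (ivl b) :: [])) (i + 0) :=
              Dg.pair (ivl b) u [] i 0 hu (Dg.nil 0)
            rw [ivl_ivl] at h1
            have h2 := Dg.insert h1 hv s y rfl
            have h3 : ivl c :: (s ++ [ivl b]) ∈ Y := by
              have := hrot [ivl b] (ivl c :: s) (by simpa using hb)
              simpa using this
            have := Dg.face c (s ++ [ivl b]) (u ++ b :: y) _ h3 (by simpa using h2)
            exact (by simpa using this : Dg Y _ _).mono _ (by omega)
        | cons e t =>
          rw [List.cons_append, List.cons.injEq] at ht
          obtain ⟨rfl, ht⟩ := ht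
          have := Dg.pair c _ _ _ _ hu (ihv t s y b (by omega) hb ht)
          exact (by simpa using this : Dg Y _ _).mono _ (by omega)
      ·
        rcases List.append_eq_append_iff.1 ht with ⟨t', rfl, ht'⟩ | ⟨t', rfl, ht'⟩
        ·
          subst ht'
          have := Dg.pair c _ _ _ _ (ihu x s t' b (by omega) hb (by simp)) hv
          exact (by simpa using this : Dg Y _ _).mono _ (by omega)
        · cases t' with
          | nil =>
            have ht'' : ivl c :: v = y := by simpa using ht'
            subst ht''
            have := Dg.pair c _ v _ j (ihu x t [] b (by omega) (by simpa using hb) (by simp)) hv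
            exact (by simpa using this : Dg Y _ _).mono _ (by omega)
          | cons e s2 =>
            have ht'' : ivl c = e ∧ v = s2 ++ y := by simpa using ht'
            obtain ⟨rfl, rfl⟩ := ht''
            have h0 : Dg Y (t ++ x) i := hC i (by omega) _ _ hu
            have h1 : Dg Y (ivl b :: ((t ++ x) ++ ivl (ivl b) :: [])) (i + 0) :=
              Dg.pair (ivl b) (t ++ x) [] i 0 h0 (Dg.nil 0)
            rw [ivl_ivl] at h1
            have h2 := Dg.insert h1 hv s2 y rfl
            have h3 : ivl c :: (s2 ++ ivl b :: t) ∈ Y := by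
              have := hrot (ivl b :: t) (ivl c :: s2) (by simpa using hb)
              simpa using this
            have := Dg.face c (s2 ++ ivl b :: t) (x ++ b :: y) _ h3 (by simpa using h2)
            exact (by simpa using this : Dg Y _ _).mono _ (by omega)
  | face c s' w' k' hs' hw' ih =>
    intro x s y b hk hb h
    cases x with
    | nil =>
      have h' : c :: w' = s ++ y := by simpa using h
      exact Dg.face b s y _ hb (h' ▸ Dg.face c s' w' k' hs' hw')
    | cons d x =>
      rw [List.cons_append, List.cons.injEq] at h
      obtain ⟨rfl, rfl⟩ := h
      have := ih (s' ++ x) s y b (by omega) hb (by simp)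
      exact Dg.face c s' _ _ hs' (by simpa using this)

theorem Dg.rot_of_single {k : ℕ}
    (h1 : ∀ (b : α × Bool) (w : List (α × Bool)), Dg Y (b :: w) k → Dg Y (w ++ [b]) k) :
    ∀ w₁ w₂ : List (α × Bool), Dg Y (w₁ ++ w₂) k → Dg Y (w₂ ++ w₁) k := by
  intro w₁
  induction w₁ with
  | nil => intro w₂ h; simpa using h
  | cons b w₁ ih =>
    intro w₂ h
    have := ih (w₂ ++ [b]) (by simpa using h1 b _ h)
    simpa using this

theorem Dg.rotate (hrot : ∀ a b : List (α × Bool), a ++ b ∈ Y → b ++ a ∈ Y) (k : ℕ) :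
    ∀ w₁ w₂ : List (α × Bool), Dg Y (w₁ ++ w₂) k → Dg Y (w₂ ++ w₁) k := by
  induction k using Nat.strong_induction_on with
  | _ k IH =>
    apply Dg.rot_of_single
    intro b w h
    cases h with
    | pair _ u v i j hu hv =>
      have h1 : Dg Y (ivl b :: (v ++ ivl (ivl b) :: [])) (j + 0) :=
        Dg.pair (ivl b) v [] j 0 hv (Dg.nil 0)
      rw [ivl_ivl] at h1
      have := Dg.append hu h1
      simpa using this
    | face _ s _ k hs hw =>
      have h1 := IH k (by omega) _ _ hw
      have := Dg.weak hrot k (fun l hl => IH l (by omega)) h1 w s [] b le_rfl hs (by simp)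
      exact this

theorem Dg.derel (hrot : ∀ a b : List (α × Bool), a ++ b ∈ Y → b ++ a ∈ Y)
    {w : List (α × Bool)} {k : ℕ} (hw : Dg Y w k) :
    ∀ y z : List (α × Bool), z ∈ Y → w = y ++ z → Dg Y y (k + 1) := by
  induction hw with
  | nil k =>
    intro y z hz h
    obtain ⟨rfl, rfl⟩ := List.append_eq_nil_iff.1 h.symm
    exact Dg.nil _
  | pair b u v i j hu hv ihu ihv =>
    intro y z hz h
    cases y with
    | nil => exact Dg.nil _
    | cons d y =>
      rw [List.cons_append, List.cons.injEq] at h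
      obtain ⟨rfl, h⟩ := h
      have key : ∀ t : List (α × Bool), u = y ++ t → z = t ++ ivl b :: v →
          Dg Y (b :: y) (i + j + 1) := by
        rintro t rfl rfl
        have h1 := Dg.rotate hrot _ _ _ hu
        have h2 := Dg.append hv h1
        have h3 : ivl b :: (v ++ t) ∈ Y := by
          have := hrot t (ivl b :: v) hz
          simpa using this
        exact (Dg.face b (v ++ t) y _ h3 (by simpa using h2)).mono _ (by omega)
      rcases List.append_eq_append_iff.1 h with ⟨t, rfl, ht⟩ | ⟨t, rfl, ht⟩
      · cases t with
        | nil => exact key [] (by simp) (by simpa using ht.symm)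
        | cons e t =>
          rw [List.cons_append, List.cons.injEq] at ht
          obtain ⟨rfl, ht⟩ := ht
          have := Dg.pair b _ _ _ _ hu (ihv t z hz ht)
          exact this.mono _ (by omega)
      · exact key t rfl ht
  | face b s w' k' hs hw' ih =>
    intro y z hz h
    cases y with
    | nil => exact Dg.nil _
    | cons d y =>
      rw [List.cons_append, List.cons.injEq] at h
      obtain ⟨rfl, rfl⟩ := h
      exact Dg.face b s y _ hs (ih (s ++ y) z hz (by simp))

theorem Dg.cancel (hrot : ∀ a b : List (α × Bool), a ++ b ∈ Y → b ++ a ∈ Y)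
    {w : List (α × Bool)} {k : ℕ} (hw : Dg Y w k) :
    ∀ (x y : List (α × Bool)) (a : α × Bool), w = x ++ a :: ivl a :: y → Dg Y (x ++ y) k := by
  induction hw with
  | nil k => intro x y a h; simp at h
  | pair b u v i j hu hv ihu ihv =>
    intro x y a h
    cases x with
    | nil =>
      have h' : b = a ∧ u ++ ivl b :: v = ivl a :: y := by simpa using h
      obtain ⟨rfl, h⟩ := h'
      cases u with
      | nil =>
        have : v = y := by simpa using h
        subst this
        exact hv.mono _ (by omega)
      | cons e u =>
        have h' : e = ivl b ∧ u ++ ivl b :: v = y := by simpa using h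
        obtain ⟨rfl, rfl⟩ := h'
        have h1 : Dg Y (u ++ [ivl b]) i := Dg.rotate hrot i [ivl b] u (by simpa using hu)
        have := Dg.append h1 hv
        simpa using this
    | cons d x =>
      rw [List.cons_append, List.cons.injEq] at h
      obtain ⟨rfl, h⟩ := h
      have key : u = x → ivl b = a → v = ivl a :: y → Dg Y (b :: x ++ y) (i + j) := by
        rintro rfl rfl rfl
        rw [ivl_ivl] at hv
        have := Dg.insert hu hv [b] y rfl
        simpa [add_comm] using this
      rcases List.append_eq_append_iff.1 h with ⟨t, rfl, ht⟩ | ⟨t, rfl, ht⟩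
      · cases t with
        | nil =>
          have ht' : ivl b = a ∧ v = ivl a :: y := by simpa using ht
          exact key (by simp) ht'.1 ht'.2 |> fun h => by simpa using h
        | cons e t =>
          rw [List.cons_append, List.cons.injEq] at ht
          obtain ⟨rfl, ht⟩ := ht
          have := Dg.pair b _ _ _ _ hu (ihv t y a ht)
          simpa using this
      · cases t with
        | nil =>
          have ht' : a = ivl b ∧ ivl a :: y = v := by simpa using ht
          exact key (by simp) ht'.1.symm ht'.2.symm
        | cons e t =>
          rw [List.cons_append, List.cons.injEq] at ht
          obtain ⟨rfl, ht⟩ := ht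
          cases t with
          | nil =>
            have ht' : ivl a = ivl b ∧ y = v := by simpa using ht
            obtain ⟨hab, rfl⟩ := ht'
            have hab' : a = b := by rw [← ivl_ivl a, hab, ivl_ivl]
            subst hab'
            have h1 : Dg Y ([a] ++ x) i := Dg.rotate hrot i x [a] hu
            have := Dg.append h1 hv
            simpa using this
          | cons f t =>
            rw [List.cons_append, List.cons.injEq] at ht
            obtain ⟨rfl, rfl⟩ := ht
            have := Dg.pair b _ _ _ _ (ihu x t a rfl) hv
            simpa using this
  | face b s w' k' hs hw' ih =>
    intro x y a h
    cases x with
    | nil =>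
      have h' : b = a ∧ w' = ivl a :: y := by simpa using h
      obtain ⟨rfl, rfl⟩ := h'
      have h1 : Dg Y (y ++ (s ++ [ivl b])) k' :=
        Dg.rotate hrot k' (s ++ [ivl b]) y (by simpa using hw')
      exact Dg.derel hrot h1 y (s ++ [ivl b]) (hrot [ivl b] s (by simpa using hs)) rfl
    | cons d x =>
      rw [List.cons_append, List.cons.injEq] at h
      obtain ⟨rfl, rfl⟩ := h
      have := ih (s ++ x) y a (by simp)
      exact Dg.face b s _ _ hs (by simpa using this)

theorem Dg.red (hrot : ∀ a b : List (α × Bool), a ++ b ∈ Y → b ++ a ∈ Y)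
    {w w' : List (α × Bool)} {k : ℕ} (h : FreeGroup.Red w w') : Dg Y w k ↔ Dg Y w' k := by
  induction h with
  | refl => rfl
  | tail _ hstep ih =>
    rw [ih]
    cases hstep with
    | @not L₁ L₂ x b =>
      constructor
      · intro h
        exact Dg.cancel hrot h L₁ L₂ (x, b) rfl
      · intro h
        have h0 : Dg Y ((x, b) :: ([] ++ ivl (x, b) :: [])) (0 + 0) :=
          Dg.pair (x, b) [] [] 0 0 (Dg.nil 0) (Dg.nil 0)
        have := Dg.insert h0 h L₁ L₂ rfl
        simpa [ivl] using this

theorem Dg.of_mk_eq (hrot : ∀ a b : List (α × Bool), a ++ b ∈ Y → b ++ a ∈ Y)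
    {w w' : List (α × Bool)} {k : ℕ} (h : FreeGroup.mk w = FreeGroup.mk w') (hw : Dg Y w k) :
    Dg Y w' k := by
  obtain ⟨c, h1, h2⟩ := FreeGroup.Red.exact.1 h
  exact (Dg.red hrot h2).2 ((Dg.red hrot h1).1 hw)

theorem Dg.of_rel (hrot : ∀ a b : List (α × Bool), a ++ b ∈ Y → b ++ a ∈ Y)
    (hinv : ∀ z ∈ Y, FreeGroup.invRev z ∈ Y) {z : List (α × Bool)} (hz : z ∈ Y) : Dg Y z 1 := by
  cases z with
  | nil => exact Dg.nil 1
  | cons b z =>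
    have h1 : ivl b :: FreeGroup.invRev z ∈ Y := by
      have := hinv _ (hrot [b] z (by simpa using hz))
      simpa [FreeGroup.invRev, ivl] using this
    refine Dg.face b (FreeGroup.invRev z) z 0 h1 (Dg.of_mk_eq hrot ?_ (Dg.nil 0))
    rw [← FreeGroup.mul_mk, ← FreeGroup.inv_mk, inv_mul_cancel]
    rfl

theorem Dg.of_prod (hrot : ∀ a b : List (α × Bool), a ++ b ∈ Y → b ++ a ∈ Y)
    (hinv : ∀ z ∈ Y, FreeGroup.invRev z ∈ Y)
    (L : List (List (α × Bool) × List (α × Bool))) (hL : ∀ p ∈ L, p.1 ∈ Y) :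
    ∀ w, FreeGroup.mk w = (L.map fun p =>
      (FreeGroup.mk p.2)⁻¹ * FreeGroup.mk p.1 * FreeGroup.mk p.2).prod → Dg Y w L.length := by
  induction L with
  | nil =>
    intro w hw
    exact Dg.of_mk_eq hrot (by rw [hw]; rfl) (Dg.nil 0)
  | cons p L ih =>
    intro w hw
    obtain ⟨w', hw'⟩ : ∃ w', FreeGroup.mk w' = (L.map fun p =>
      (FreeGroup.mk p.2)⁻¹ * FreeGroup.mk p.1 * FreeGroup.mk p.2).prod :=
      Quot.exists_rep _
    have h1 := ih (fun q hq => hL q (by simp [hq])) w' hw'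
    have h2 : Dg Y (FreeGroup.invRev p.2 ++ p.2) 0 := by
      refine Dg.of_mk_eq hrot ?_ (Dg.nil 0)
      rw [← FreeGroup.mul_mk, ← FreeGroup.inv_mk, inv_mul_cancel]
      rfl
    have h3 := Dg.insert (Dg.of_rel hrot hinv (hL p (by simp))) h2 _ _ rfl
    have h4 := Dg.append h3 h1
    have h5 := Dg.of_mk_eq (w' := w) hrot (by
      rw [hw, List.map_cons, List.prod_cons, ← hw', FreeGroup.inv_mk, FreeGroup.mul_mk,
        FreeGroup.mul_mk, FreeGroup.mul_mk]) h4
    exact h5.mono _ (by simp; omega)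

end DgLemmas

/-- `g` is a product of at most `N` conjugates of elements of `S` or their inverses. -/
def Ar {α : Type} (S : Finset (List (α × Bool))) (g : FreeGroup α) (N : ℕ) : Prop :=
  ∃ L : List (List (α × Bool) × List (α × Bool)),
    (∀ p ∈ L, p.1 ∈ S ∨ FreeGroup.invRev p.1 ∈ S) ∧ L.length ≤ N ∧
    g = (L.map fun p => (FreeGroup.mk p.2)⁻¹ * FreeGroup.mk p.1 * FreeGroup.mk p.2).prod

section ArLemmas
variable {α : Type} {S : Finset (List (α × Bool))}

theorem Ar.one : Ar S 1 0 := ⟨[], by simp, by simp, by simp⟩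

theorem Ar.mul {g h : FreeGroup α} {M N : ℕ} (hg : Ar S g M) (hh : Ar S h N) :
    Ar S (g * h) (M + N) := by
  obtain ⟨L, h1, h2, rfl⟩ := hg
  obtain ⟨L', h1', h2', rfl⟩ := hh
  refine ⟨L ++ L', ?_, ?_, ?_⟩
  · intro p hp
    rcases List.mem_append.1 hp with hp | hp
    · exact h1 p hp
    · exact h1' p hp
  · simp; omega
  · simp

theorem Ar.conj {g : FreeGroup α} {N : ℕ} (hg : Ar S g N) (c : List (α × Bool)) :
    Ar S ((FreeGroup.mk c)⁻¹ * g * FreeGroup.mk c) N := by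
  obtain ⟨L, h1, h2, rfl⟩ := hg
  refine ⟨L.map fun p => (p.1, p.2 ++ c), ?_, by simpa using h2, ?_⟩
  · intro p hp
    obtain ⟨q, hq, rfl⟩ := List.mem_map.1 hp
    exact h1 q hq
  · clear h1 h2
    induction L with
    | nil => simp only [List.map_nil, List.prod_nil, mul_one, inv_mul_cancel]
    | cons p L ih =>
      simp only [List.map_cons, List.prod_cons] at ih ⊢
      rw [← ih, ← FreeGroup.mul_mk]
      group

theorem Ar.rel {z : List (α × Bool)} (hz : z ∈ S) : Ar S (FreeGroup.mk z) 1 :=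
  ⟨[(z, [])], by simp [hz], by simp, by simp⟩

end ArLemmas

/-- Replacement of some of the non-outer letters (mark `false`) by the complementary
part of a relator; the number counts the replaced letters. -/
inductive Rp {α : Type} (Y : Set (List (α × Bool))) :
    List ((α × Bool) × Bool) → List (α × Bool) → ℕ → Prop
  | nil : Rp Y [] [] 0
  | keep (x : α × Bool) (c : Bool) (W : List ((α × Bool) × Bool)) (v : List (α × Bool)) (p : ℕ) :
      Rp Y W v p → Rp Y ((x, c) :: W) (x :: v) p
  | repl (x : α × Bool) (s : List (α × Bool)) (W : List ((α × Bool) × Bool))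
      (v : List (α × Bool)) (p : ℕ) :
      (ivl x :: s) ∈ Y → Rp Y W v p → Rp Y ((x, false) :: W) (s ++ v) (p + 1)

section RpLemmas
variable {α : Type} {Y : Set (List (α × Bool))}

theorem Rp.append {W W' : List ((α × Bool) × Bool)} {v v' : List (α × Bool)} {p p' : ℕ}
    (h : Rp Y W v p) (h' : Rp Y W' v' p') : Rp Y (W ++ W') (v ++ v') (p + p') := by
  induction h with
  | nil => simpa using h'
  | keep x c W v p _ ih => exact Rp.keep x c _ _ _ ih
  | repl x s W v p hs _ ih =>
    have := Rp.repl x s _ _ _ hs ih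
    rw [show p + 1 + p' = p + p' + 1 by omega]
    simpa using this

theorem Rp.split : ∀ (W W' : List ((α × Bool) × Bool)) {v : List (α × Bool)} {p : ℕ},
    Rp Y (W ++ W') v p → ∃ v₁ v₂ p₁ p₂, Rp Y W v₁ p₁ ∧ Rp Y W' v₂ p₂ ∧ v = v₁ ++ v₂ ∧
      p = p₁ + p₂ := by
  intro W
  induction W with
  | nil => intro W' v p h; exact ⟨[], v, 0, p, Rp.nil, h, rfl, by omega⟩
  | cons x W ih =>
    intro W' v p h
    cases h with
    | keep x c _ v p h =>
      obtain ⟨v₁, v₂, p₁, p₂, h1, h2, rfl, rfl⟩ := ih W' h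
      exact ⟨_, v₂, p₁, p₂, Rp.keep x c _ _ _ h1, h2, rfl, rfl⟩
    | repl x s _ v p hs h =>
      obtain ⟨v₁, v₂, p₁, p₂, h1, h2, rfl, rfl⟩ := ih W' h
      exact ⟨_, v₂, _, p₂, Rp.repl x s _ _ _ hs h1, h2, by simp, by omega⟩

theorem Rp.zero {W : List ((α × Bool) × Bool)} {v : List (α × Bool)} {p : ℕ}
    (h : Rp Y W v p) : p = 0 → v = W.map Prod.fst := by
  induction h with
  | nil => simp
  | keep x c W v p _ ih => intro hp; simp [ih hp]
  | repl => intro hp; omega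

theorem Rp.outer {W : List ((α × Bool) × Bool)} {v : List (α × Bool)} {p : ℕ}
    (h : Rp Y W v p) : (∀ x ∈ W, x.2 = true) → v = W.map Prod.fst := by
  induction h with
  | nil => simp
  | keep x c W v p _ ih =>
    intro hp
    simp [ih (fun y hy => hp y (by simp [hy]))]
  | repl x s W v p => intro hp; simpa using hp (x, false) (by simp)

theorem Rp.length {m : ℕ} (hm : 1 ≤ m) (hY : ∀ z ∈ Y, z.length ≤ m)
    {W : List ((α × Bool) × Bool)} {v : List (α × Bool)} {p : ℕ}
    (h : Rp Y W v p) : v.length ≤ m * W.length := by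
  induction h with
  | nil => simp
  | keep x c W v p _ ih => simp only [List.length_cons]; rw [mul_add]; omega
  | repl x s W v p hs _ ih =>
    have := hY _ hs
    simp only [List.length_cons, List.length_append] at this ⊢
    rw [mul_add]; omega

theorem Rp.triv {H : Subgroup (FreeGroup α)} [H.Normal] (hY : ∀ z ∈ Y, FreeGroup.mk z ∈ H)
    {W : List ((α × Bool) × Bool)} {v : List (α × Bool)} {p : ℕ}
    (h : Rp Y W v p) : (QuotientGroup.mk (FreeGroup.mk v) : FreeGroup α ⧸ H) =
      QuotientGroup.mk (FreeGroup.mk (W.map Prod.fst)) := by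
  induction h with
  | nil => rfl
  | keep x c W v p _ ih =>
    have e : ∀ l : List (α × Bool), FreeGroup.mk (x :: l) = FreeGroup.mk [x] * FreeGroup.mk l := by
      intro l; simp [FreeGroup.mul_mk]
    rw [List.map_cons, e v, e (W.map Prod.fst), QuotientGroup.mk_mul, QuotientGroup.mk_mul, ih]
  | repl x s W v p hs _ ih =>
    have e : FreeGroup.mk (x :: W.map Prod.fst) =
        FreeGroup.mk [x] * FreeGroup.mk (W.map Prod.fst) := by
      simp [FreeGroup.mul_mk]
    rw [List.map_cons, e, ← FreeGroup.mul_mk, QuotientGroup.mk_mul, QuotientGroup.mk_mul, ih]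
    congr 1
    have h1 := hY _ hs
    have e2 : FreeGroup.mk (ivl x :: s) = (FreeGroup.mk [x])⁻¹ * FreeGroup.mk s := by
      simp [FreeGroup.mul_mk, FreeGroup.inv_mk, FreeGroup.invRev, ivl]
    rw [e2] at h1
    exact (QuotientGroup.eq.2 h1).symm

end RpLemmas

theorem compress {α : Type} {Y : Set (List (α × Bool))} {S : Finset (List (α × Bool))}
    {H : Subgroup (FreeGroup α)} [H.Normal] {m : ℕ} (hm : 1 ≤ m)
    (hlen : ∀ z ∈ Y, z.length ≤ m) (hYH : ∀ z ∈ Y, FreeGroup.mk z ∈ H)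
    (hS : ∀ z : List (α × Bool), z.length ≤ m * m + 1 → FreeGroup.mk z ∈ H → z ∈ S)
    {w : List (α × Bool)} {k : ℕ} (h : Dg Y w k) :
    ∀ W : List ((α × Bool) × Bool), W.map Prod.fst = w →
      ∃ v p N, Rp Y W v p ∧ Ar S (FreeGroup.mk v) N ∧
        2 * N + p ≤ k + W.countP (fun x => x.2) := by
  induction h with
  | nil k =>
    intro W hW
    have : W = [] := by simpa using hW
    subst this
    exact ⟨[], 0, 0, Rp.nil, Ar.one, by simp⟩
  | pair a u v i j _ _ ihu ihv =>
    intro W hW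
    obtain ⟨⟨a', c⟩, W, rfl, rfl, hW⟩ := List.map_eq_cons_iff.1 hW
    obtain ⟨U, V', rfl, rfl, hV⟩ := List.map_eq_append_iff.1 hW
    obtain ⟨⟨b, c'⟩, V, rfl, hb, rfl⟩ := List.map_eq_cons_iff.1 hV
    simp only at hb
    subst hb
    obtain ⟨v1, p1, N1, h1, h1', h1''⟩ := ihu U rfl
    obtain ⟨v2, p2, N2, h2, h2', h2''⟩ := ihv V rfl
    refine ⟨_, _, N1 + N2, Rp.keep a' c _ _ _ (Rp.append h1 (Rp.keep _ c' _ _ _ h2)), ?_, ?_⟩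
    · have := (h1'.conj [ivl a']).mul h2'
      convert this using 1
      simp [FreeGroup.mul_mk, FreeGroup.inv_mk, FreeGroup.invRev, ivl]
    · simp only [List.countP_cons, List.countP_append]
      omega
  | face a s w k hs _ ih =>
    intro W hW
    obtain ⟨⟨a', c⟩, W, rfl, rfl, rfl⟩ := List.map_eq_cons_iff.1 hW
    simp only at hs
    have hsm : (s.map fun x => (x, false)).map Prod.fst = s := by simp [Function.comp_def]
    obtain ⟨v, p, N, h1, h2, h3⟩ := ih ((s.map fun x => (x, false)) ++ W) (by
      rw [List.map_append, hsm])
    obtain ⟨t, v, q, p, h4, h5, rfl, rfl⟩ := Rp.split _ _ h1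
    have hc0 : (s.map fun x => (x, false)).countP (fun x : (α × Bool) × Bool => x.2) = 0 := by
      rw [List.countP_eq_zero]; simp
    rw [List.countP_append, hc0] at h3
    have hkeep : Ar S (FreeGroup.mk (a' :: v)) (N + 1) := by
      have hmem : a' :: FreeGroup.invRev t ∈ S := by
        apply hS
        · have l1 := h4.length hm hlen
          have l2 := hlen _ hs
          simp only [List.length_cons, List.length_map, FreeGroup.invRev_length] at l1 l2 ⊢
          have : m * s.length ≤ m * m := Nat.mul_le_mul_left _ (by omega)
          omega
        · have e1 := h4.triv hYH
          rw [hsm] at e1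
          have e2 := hYH _ hs
          have e3 : FreeGroup.mk (ivl a' :: s) = (FreeGroup.mk [a'])⁻¹ * FreeGroup.mk s := by
            simp [FreeGroup.mul_mk, FreeGroup.inv_mk, FreeGroup.invRev, ivl]
          rw [e3] at e2
          have e4 := (QuotientGroup.eq.2 e2).trans e1.symm
          have e5 : FreeGroup.mk (a' :: FreeGroup.invRev t) =
              FreeGroup.mk [a'] * (FreeGroup.mk t)⁻¹ := by
            simp [FreeGroup.mul_mk, FreeGroup.inv_mk]
          rw [e5, ← QuotientGroup.eq_one_iff, QuotientGroup.mk_mul, QuotientGroup.mk_inv, e4,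
            mul_inv_cancel]
      have := (Ar.rel hmem).mul h2
      rw [add_comm]
      convert this using 1
      have e5 : FreeGroup.mk (a' :: FreeGroup.invRev t) =
          FreeGroup.mk [a'] * (FreeGroup.mk t)⁻¹ := by
        simp [FreeGroup.mul_mk, FreeGroup.inv_mk]
      rw [e5, ← FreeGroup.mul_mk]
      have e6 : FreeGroup.mk (a' :: v) = FreeGroup.mk [a'] * FreeGroup.mk v := by
        simp [FreeGroup.mul_mk]
      rw [e6]; group
    cases c with
    | true =>
      refine ⟨_, _, N + 1, Rp.keep a' true _ _ _ h5, hkeep, ?_⟩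
      simp only [List.countP_cons]
      simp; omega
    | false =>
      by_cases hq : q = 0
      · have := h4.zero hq
        rw [hsm] at this
        subst this
        refine ⟨_, _, N, Rp.repl a' t _ _ _ hs h5, h2, ?_⟩
        simp only [List.countP_cons]
        simp; omega
      · refine ⟨_, _, N + 1, Rp.keep a' false _ _ _ h5, hkeep, ?_⟩
        simp only [List.countP_cons]
        simp; omega


/-- Linear compression of the isoperimetric function: If a group `G` has a
finite presentation with isoperimetric function at most `P(·)` — i.e. every trivial word
`w` is equal in the free group to a product of at most `P(|w|)` conjugates of relators —
then `G` also has a finite presentation whose isoperimetric function is at most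
`n ↦ P(n)/2 + n/2` (expressed without division: the number of factors `N` satisfies
`2·N ≤ P(|w|) + |w|`). -/
theorem stmt16 (G : Type) [Group G] (P : ℕ → ℕ)
    (h : ∃ (α : Type) (_ : Fintype α) (R : Finset (List (α × Bool))),
      IsFinPresentationOf G R ∧
      ∀ w : List (α × Bool), WordTrivial R w →
        ∃ L : List (List (α × Bool) × List (α × Bool)),
          (∀ p ∈ L, p.1 ∈ R ∨ FreeGroup.invRev p.1 ∈ R) ∧
          L.length ≤ P w.length ∧
          FreeGroup.mk w = (L.map fun p =>
            (FreeGroup.mk p.2)⁻¹ * FreeGroup.mk p.1 * FreeGroup.mk p.2).prod) :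
    ∃ (β : Type) (_ : Fintype β) (S : Finset (List (β × Bool))),
      IsFinPresentationOf G S ∧
      ∀ w : List (β × Bool), WordTrivial S w →
        ∃ L : List (List (β × Bool) × List (β × Bool)),
          (∀ p ∈ L, p.1 ∈ S ∨ FreeGroup.invRev p.1 ∈ S) ∧
          2 * L.length ≤ P w.length + w.length ∧
          FreeGroup.mk w = (L.map fun p =>
            (FreeGroup.mk p.2)⁻¹ * FreeGroup.mk p.1 * FreeGroup.mk p.2).prod := by
  classical
  obtain ⟨α, hα, R, hG, hP⟩ := h
  let H : Subgroup (FreeGroup α) :=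
    Subgroup.normalClosure (FreeGroup.mk '' (R : Set (List (α × Bool))))
  have hHn : H.Normal := Subgroup.normalClosure_normal
  obtain ⟨m, hm, hRm⟩ : ∃ m, 1 ≤ m ∧ ∀ r ∈ R, r.length ≤ m :=
    ⟨R.sup List.length + 1, by omega, fun r hr =>
      (Finset.le_sup (f := List.length) hr).trans (by omega)⟩
  let Y : Set (List (α × Bool)) :=
    {z | ∃ r, (r ∈ R ∨ FreeGroup.invRev r ∈ R) ∧ z ~r r}
  have hrot : ∀ a b : List (α × Bool), a ++ b ∈ Y → b ++ a ∈ Y := by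
    rintro a b ⟨r, hr, h⟩
    exact ⟨r, hr, List.isRotated_append.trans h⟩
  have hinv : ∀ z ∈ Y, FreeGroup.invRev z ∈ Y := by
    rintro z ⟨r, hr, h⟩
    refine ⟨FreeGroup.invRev r, ?_, ?_⟩
    · rw [FreeGroup.invRev_invRev]; exact hr.symm
    · exact (h.map _).reverse
  have hlen : ∀ z ∈ Y, z.length ≤ m := by
    rintro z ⟨r, hr, h⟩
    rw [h.perm.length_eq]
    rcases hr with hr | hr
    · exact hRm r hr
    · simpa using hRm _ hr
  have hRH : ∀ r ∈ R, FreeGroup.mk r ∈ H := fun r hr =>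
    Subgroup.subset_normalClosure ⟨r, hr, rfl⟩
  have hYH : ∀ z ∈ Y, FreeGroup.mk z ∈ H := by
    rintro z ⟨r, hr, h⟩
    have h1 : FreeGroup.mk r ∈ H := by
      rcases hr with hr | hr
      · exact hRH r hr
      · have := hRH _ hr
        rw [← FreeGroup.inv_mk] at this
        exact inv_mem_iff.1 this
    obtain ⟨n, hn⟩ := h.symm
    rw [← hn, List.rotate_eq_drop_append_take_mod, ← FreeGroup.mul_mk]
    apply hHn.mem_comm
    rw [FreeGroup.mul_mk, List.take_append_drop]
    exact h1
  have hfin : {z : List (α × Bool) | z.length ≤ m * m + 1 ∧ FreeGroup.mk z ∈ H}.Finite :=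
    (List.finite_length_le (α × Bool) (m * m + 1)).subset fun z hz => hz.1
  have hSmem : ∀ z, z ∈ hfin.toFinset ↔ z.length ≤ m * m + 1 ∧ FreeGroup.mk z ∈ H := by
    intro z; simp
  have hHS : Subgroup.normalClosure
      (FreeGroup.mk '' (hfin.toFinset : Set (List (α × Bool)))) = H := by
    apply le_antisymm
    · apply Subgroup.normalClosure_le_normal
      rintro _ ⟨z, hz, rfl⟩
      exact ((hSmem z).1 hz).2
    · apply Subgroup.normalClosure_mono
      rintro _ ⟨z, hz, rfl⟩
      refine ⟨z, (hSmem z).2 ⟨?_, hRH z hz⟩, rfl⟩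
      have := hRm z hz
      nlinarith
  refine ⟨α, hα, hfin.toFinset, ?_, ?_⟩
  · obtain ⟨e⟩ := hG
    exact ⟨(QuotientGroup.quotientMulEquivOfEq hHS).trans e⟩
  · intro w hw
    have hw' : WordTrivial R w := by
      unfold WordTrivial at hw
      rw [hHS] at hw
      exact hw
    obtain ⟨L, hL, hLl, hLw⟩ := hP w hw'
    have hD := Dg.of_prod hrot hinv L (fun p hp => ⟨p.1, hL p hp, List.IsRotated.refl _⟩) w hLw
    have hwm : (w.map fun x => (x, true)).map Prod.fst = w := by simp [Function.comp_def]
    obtain ⟨v, p, N, h1, h2, h3⟩ := compress (S := hfin.toFinset) hm hlen hYH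
      (fun z hz hz' => (hSmem z).2 ⟨hz, hz'⟩) hD (w.map fun x => (x, true)) hwm
    have hv := h1.outer (by simp)
    rw [hwm] at hv
    subst hv
    obtain ⟨L', hL', hN, hprod⟩ := h2
    refine ⟨L', hL', ?_, hprod⟩
    have := List.countP_le_length (p := fun x : (α × Bool) × Bool => x.2)
      (l := v.map fun x => (x, true))
    rw [List.length_map] at this
    omega
end
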